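/- Fix λ ∈ (0,1/2), a cutoff ζ, γ ∈ [0,1), a kernel K satisfying the standing assumptions, ρ ∈ (γ,1), β = 1/(ρ−γ). For every h₀ ∈ 𝒳_ρ the unique mild solution H of the regularized problem extends globally, i.e. exists for all t > 0, and for every T > 0 one has sup_{0≤t≤T} ‖H(·,t)‖_{𝒳_ρ} ≤ ‖h₀‖_{𝒳_ρ} e^{βρT}; in particular the bound is independent of λ. -/

import Mathlib

open MeasureTheory Real Set Filter Topology

noncomputable section

namespace Smol

/-- Standing assumptions on the coagulation kernel `K`: continuity on `(0,∞)²`, symmetry,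
nonnegativity, homogeneity of degree `γ` and the growth bound `K(x,y) ≤ C(x^γ + y^γ)`. -/
structure KernelHyp (K : ℝ → ℝ → ℝ) (γ C : ℝ) : Prop where
  cont : ContinuousOn (fun p : ℝ × ℝ => K p.1 p.2) (Ioi (0:ℝ) ×ˢ Ioi (0:ℝ))
  symm : ∀ x y : ℝ, 0 < x → 0 < y → K x y = K y x
  nonneg : ∀ x y : ℝ, 0 < x → 0 < y → 0 ≤ K x y
  homog : ∀ a x y : ℝ, 0 < a → 0 < x → 0 < y → K (a * x) (a * y) = a ^ γ * K x y
  growth : ∀ x y : ℝ, 0 < x → 0 < y → K x y ≤ C * (x ^ γ + y ^ γ)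

/-- A smooth monotone cutoff `ζ`, vanishing on `[0,1/2]` and equal to `1` on `[1,∞)`. -/
structure CutoffHyp (ζ : ℝ → ℝ) : Prop where
  smooth : ContDiffOn ℝ (⊤ : ℕ∞) ζ (Ici (0:ℝ))
  mono : MonotoneOn ζ (Ici (0:ℝ))
  zero : ∀ s : ℝ, s ≤ 1/2 → ζ s = 0
  one : ∀ s : ℝ, 1 ≤ s → ζ s = 1

/-- The regularized kernel `K_λ`. -/
def Kreg (K : ℝ → ℝ → ℝ) (ζ : ℝ → ℝ) (lam : ℝ) (y z : ℝ) : ℝ :=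
  K y z * ζ (y / lam) * ζ (z / lam) * ζ (y / (lam * (y + z))) * ζ (z / (lam * (y + z)))

/-- Membership in the space `𝒳_ρ` of nonnegative Radon measures on `[0,∞)` with
`sup_{R>0} (∫_{[0,R]} dh)/R^{1-ρ} < ∞`. -/
def MemX (ρ : ℝ) (μ : Measure ℝ) : Prop :=
  μ (Iio 0) = 0 ∧ ∃ M : ℝ, ∀ R > (0:ℝ), μ (Icc 0 R) ≤ ENNReal.ofReal (M * R ^ (1 - ρ))

/-- The norm `‖h‖_{𝒳_ρ} = sup_{R>0} (∫_{[0,R]} dh)/R^{1-ρ}`, expressed as the least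
admissible constant. -/
def Xnorm (ρ : ℝ) (μ : Measure ℝ) : ℝ :=
  sInf {M : ℝ | 0 ≤ M ∧ ∀ R > (0:ℝ), μ (Icc 0 R) ≤ ENNReal.ofReal (M * R ^ (1 - ρ))}

/-- The operator `𝒜[H](X,t) = ∫_0^∞ K_λ(Xe^{-βt},Ze^{-βt})/Z dH(Z,t) - βρ`. -/
def Acal (Kl : ℝ → ℝ → ℝ) (β ρ : ℝ) (H : ℝ → Measure ℝ) (X t : ℝ) : ℝ :=
  (∫ Z, Kl (X * exp (-(β * t))) (Z * exp (-(β * t))) / Z ∂(H t)) - β * ρ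

/-- The measure `𝒬[H](·,t)`, i.e. the weighted convolution
`𝒬[H](X,t) = ∫_0^X (K_λ(Ye^{-βt},(X-Y)e^{-βt})/(X-Y)) H(X-Y,t) dH(Y,t)`. -/
def Qcal (Kl : ℝ → ℝ → ℝ) (β : ℝ) (H : ℝ → Measure ℝ) (t : ℝ) : Measure ℝ :=
  Measure.map (fun p : ℝ × ℝ => p.1 + p.2)
    (((H t).prod (H t)).withDensity fun p =>
      ENNReal.ofReal (Kl (p.1 * exp (-(β * t))) (p.2 * exp (-(β * t))) / p.2))

/-- Mild solution on `[0,T]` of the regularized problem, in the sense of measures: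
`H(·,t) = h₀ e^{-∫_0^t 𝒜[H] ds} + ∫_0^t e^{-∫_s^t 𝒜[H] dξ} 𝒬[H](·,s) ds`,
together with membership in `C([0,T];𝒳_ρ)` (weak continuity in time). -/
def IsMildSolution (Kl : ℝ → ℝ → ℝ) (β ρ T : ℝ) (h0 : Measure ℝ)
    (H : ℝ → Measure ℝ) : Prop :=
  (∀ t ∈ Icc (0:ℝ) T, MemX ρ (H t)) ∧
  (∀ φ : ℝ → ℝ, Continuous φ → HasCompactSupport φ →
      ContinuousOn (fun t => ∫ X, φ X ∂(H t)) (Icc (0:ℝ) T)) ∧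
  (∀ t ∈ Icc (0:ℝ) T, ∀ φ : ℝ → ℝ, Continuous φ → HasCompactSupport φ →
      ∫ X, φ X ∂(H t)
        = (∫ X, φ X * exp (-(∫ s in (0:ℝ)..t, Acal Kl β ρ H X s)) ∂h0)
          + ∫ s in (0:ℝ)..t,
              ∫ X, φ X * exp (-(∫ ξ in s..t, Acal Kl β ρ H X ξ)) ∂(Qcal Kl β H s))

/-- The change of variables producing `h(·,t)` from `H(·,t)`:
`h(x,t) = H(xe^{βt},t)` as densities, i.e. `h(·,t) = e^{-βt}·(X ↦ Xe^{-βt})_*H(·,t)`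
as measures; `S_λ(t)h₀` is `Smap β t (H t)` for the mild solution `H` with datum `h₀`. -/
def Smap (β t : ℝ) (ν : Measure ℝ) : Measure ℝ :=
  ENNReal.ofReal (exp (-(β * t))) • Measure.map (fun X => X * exp (-(β * t))) ν

/-- Continuous functions vanishing outside a bounded set. -/
structure IsTest (φ : ℝ → ℝ) : Prop where
  cont : Continuous φ
  supp : ∃ R : ℝ, ∀ x, R < |x| → φ x = 0

theorem hasCompactSupport_of_radius {φ : ℝ → ℝ} {R : ℝ} (h : ∀ x, R < |x| → φ x = 0) :
    HasCompactSupport φ := by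
  refine HasCompactSupport.intro (isCompact_Icc (a := -R) (b := R)) fun x hx => h x ?_
  by_contra hR
  exact hx (abs_le.1 (not_lt.1 hR))

theorem isTest_iff {φ : ℝ → ℝ} : IsTest φ ↔ Continuous φ ∧ HasCompactSupport φ := by
  constructor
  · rintro ⟨hc, R, hR⟩
    exact ⟨hc, hasCompactSupport_of_radius hR⟩
  · rintro ⟨hc, hs⟩
    obtain ⟨R, hR⟩ := hs.isCompact.isBounded.subset_closedBall 0
    refine ⟨hc, R, fun x hx => image_eq_zero_of_notMem_tsupport fun hmem => ?_⟩
    have := hR hmem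
    simp only [Metric.mem_closedBall, dist_zero_right, norm_eq_abs] at this
    linarith

theorem IsTest.integrable {φ : ℝ → ℝ} (hφ : IsTest φ) (μ : Measure ℝ)
    [IsFiniteMeasureOnCompacts μ] : Integrable φ μ :=
  hφ.cont.integrable_of_hasCompactSupport (isTest_iff.1 hφ).2

theorem IsTest.mul_right {φ g : ℝ → ℝ} (hφ : IsTest φ) (hg : Continuous g) :
    IsTest fun x => φ x * g x := by
  obtain ⟨R, hR⟩ := hφ.supp
  exact ⟨hφ.cont.mul hg, R, fun x hx => by simp [hR x hx]⟩

theorem IsTest.add {φ ψ : ℝ → ℝ} (hφ : IsTest φ) (hψ : IsTest ψ) :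
    IsTest fun x => φ x + ψ x := by
  obtain ⟨R, hR⟩ := hφ.supp
  obtain ⟨S, hS⟩ := hψ.supp
  refine ⟨hφ.cont.add hψ.cont, max R S, fun x hx => ?_⟩
  rw [hR x ((le_max_left _ _).trans_lt hx), hS x ((le_max_right _ _).trans_lt hx), add_zero]

theorem IsTest.const_mul {φ : ℝ → ℝ} (hφ : IsTest φ) (c : ℝ) :
    IsTest fun x => c * φ x := by
  obtain ⟨R, hR⟩ := hφ.supp
  exact ⟨continuous_const.mul hφ.cont, R, fun x hx => by simp [hR x hx]⟩

/-- A plateau function equal to `1` on `[-R,R]` and vanishing outside `[-(R+1),R+1]`. -/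
def plateau (R x : ℝ) : ℝ := max 0 (min 1 (R + 1 - |x|))

theorem continuous_plateau (R : ℝ) : Continuous (plateau R) := by
  unfold plateau; fun_prop

theorem plateau_nonneg (R x : ℝ) : 0 ≤ plateau R x := le_max_left _ _

theorem plateau_le_one (R x : ℝ) : plateau R x ≤ 1 :=
  max_le zero_le_one (min_le_left _ _)

theorem plateau_eq_one {R x : ℝ} (h : |x| ≤ R) : plateau R x = 1 := by
  unfold plateau
  rw [min_eq_left (by linarith), max_eq_right zero_le_one]

theorem plateau_eq_zero {R x : ℝ} (h : R + 1 ≤ |x|) : plateau R x = 0 := by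
  unfold plateau
  rw [max_eq_left]
  exact (min_le_right _ _).trans (by linarith)

theorem plateau_antitoneOn (R : ℝ) : AntitoneOn (plateau R) (Ici 0) := by
  intro x hx y hy hxy
  unfold plateau
  rw [abs_of_nonneg (show 0 ≤ x from hx), abs_of_nonneg (show 0 ≤ y from hy)]
  gcongr

theorem isTest_plateau (R : ℝ) : IsTest (plateau R) :=
  ⟨continuous_plateau R, R + 1, fun _ hx => plateau_eq_zero hx.le⟩

/-- Weakly continuous families of measures that are finite on compact sets. -/
structure WeakFamily (H : ℝ → Measure ℝ) : Prop where
  fin : ∀ t, IsFiniteMeasureOnCompacts (H t)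
  cont : ∀ φ : ℝ → ℝ, IsTest φ → Continuous fun t => ∫ X, φ X ∂(H t)

theorem weakFamily_const (μ : Measure ℝ) [h : IsFiniteMeasureOnCompacts μ] :
    WeakFamily fun _ => μ :=
  ⟨fun _ => h, fun _ _ => continuous_const⟩

/-- Continuity of parametric integrals against a weakly continuous family. -/
theorem WeakFamily.continuous_integral {P : Type*} [TopologicalSpace P] {H : ℝ → Measure ℝ}
    (hH : WeakFamily H) {τ : P → ℝ} (hτ : Continuous τ) {f : P → ℝ → ℝ}
    (hf : Continuous (Function.uncurry f))
    (hs : ∀ p₀, ∃ R : ℝ, ∀ᶠ p in 𝓝 p₀, ∀ x, R < |x| → f p x = 0) :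
    Continuous fun p => ∫ x, f p x ∂(H (τ p)) := by
  have hfin := hH.fin
  rw [continuous_iff_continuousAt]
  intro p₀
  obtain ⟨R, hR⟩ := hs p₀
  have hfp : ∀ p, Continuous (f p) := fun p => hf.comp (by fun_prop : Continuous fun x => (p, x))
  have h1 : Tendsto (fun p => ∫ x, f p₀ x ∂(H (τ p))) (𝓝 p₀) (𝓝 (∫ x, f p₀ x ∂(H (τ p₀)))) :=
    ((hH.cont (f p₀) ⟨hfp p₀, R, hR.self_of_nhds⟩).comp hτ).continuousAt
  have h2 : Tendsto (fun p => ∫ x, plateau R x ∂(H (τ p))) (𝓝 p₀)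
      (𝓝 (∫ x, plateau R x ∂(H (τ p₀)))) :=
    ((hH.cont _ (isTest_plateau R)).comp hτ).continuousAt
  set m := ∫ x, plateau R x ∂(H (τ p₀)) with hm
  have hm0 : 0 ≤ m := integral_nonneg fun x => plateau_nonneg R x
  have h3 : Tendsto (fun p => ∫ x, f p x ∂(H (τ p)) - ∫ x, f p₀ x ∂(H (τ p))) (𝓝 p₀) (𝓝 0) := by
    rw [Metric.tendsto_nhds]
    intro ε hε
    have hη : 0 < ε / (m + 1) / 2 := by positivity
    set η := ε / (m + 1) / 2 with hηd
    have hunif : ∀ᶠ p in 𝓝 p₀, ∀ x ∈ Icc (-R) R, |f p x - f p₀ x| < η := by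
      refine isCompact_Icc.eventually_forall_of_forall_eventually ?_
      intro x _
      have hc : Continuous fun z : P × ℝ => |f z.1 z.2 - f p₀ z.2| := by
        have := hf
        have h' : Continuous fun z : P × ℝ => f p₀ z.2 := (hfp p₀).comp continuous_snd
        exact (hf.sub h').abs
      have := hc.tendsto (p₀, x)
      simp only [sub_self, abs_zero] at this
      exact this.eventually (gt_mem_nhds hη)
    filter_upwards [hunif, hR, h2.eventually (gt_mem_nhds (lt_add_one m))] with p hp hRp hmp
    have hi1 := IsTest.integrable ⟨hfp p, R, hRp⟩ (H (τ p))
    have hi2 := IsTest.integrable ⟨hfp p₀, R, hR.self_of_nhds⟩ (H (τ p))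
    rw [dist_zero_right, ← integral_sub hi1 hi2]
    have hb : ‖∫ x, (f p x - f p₀ x) ∂(H (τ p))‖ ≤ ∫ x, η * plateau R x ∂(H (τ p)) := by
      refine norm_integral_le_of_norm_le (((isTest_plateau R).integrable _).const_mul _)
        (Eventually.of_forall fun x => ?_)
      rcases le_or_gt |x| R with hx | hx
      · rw [plateau_eq_one hx, mul_one]
        exact (hp x (abs_le.1 hx)).le
      · rw [hRp x hx, hR.self_of_nhds x hx]
        simpa using mul_nonneg hη.le (plateau_nonneg R x)
    rw [integral_const_mul] at hb
    have hlt : η * (∫ x, plateau R x ∂(H (τ p))) ≤ η * (m + 1) := by gcongr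
    have : η * (m + 1) = ε / 2 := by rw [hηd]; field_simp
    linarith
  have := h3.add h1
  simp only [sub_add_cancel, zero_add] at this
  exact this

theorem intervalIntegral_integral_swap {μ : Measure ℝ} [IsFiniteMeasureOnCompacts μ]
    {f : ℝ → ℝ → ℝ} (hf : Continuous (Function.uncurry f)) {R : ℝ}
    (hR : ∀ r x, R < |x| → f r x = 0) (a b : ℝ) :
    ∫ r in a..b, ∫ x, f r x ∂μ = ∫ x, (∫ r in a..b, f r x) ∂μ := by
  have key : ∀ a b : ℝ, a ≤ b →
      ∫ r in a..b, ∫ x, f r x ∂μ = ∫ x, (∫ r in a..b, f r x) ∂μ := by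
    intro a b hab
    simp only [intervalIntegral.integral_of_le hab]
    refine integral_integral_swap ?_
    have h1 : IntegrableOn (Function.uncurry f) (Icc a b ×ˢ Icc (-R) R) (volume.prod μ) :=
      hf.continuousOn.integrableOn_compact (isCompact_Icc.prod isCompact_Icc)
    have h2 : IntegrableOn (Function.uncurry f) (Icc a b ×ˢ univ) (volume.prod μ) := by
      refine h1.of_forall_sdiff_eq_zero (measurableSet_Icc.prod MeasurableSet.univ) ?_
      rintro ⟨r, x⟩ ⟨⟨hr, -⟩, hx⟩
      refine hR r x ?_
      by_contra hxR
      exact hx ⟨hr, abs_le.1 (not_lt.1 hxR)⟩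
    have h3 := h2.mono_set (prod_mono_left (t := univ) (Ioc_subset_Icc_self (a := a) (b := b)))
    rw [IntegrableOn, ← Measure.prod_restrict, Measure.restrict_univ] at h3
    exact h3
  rcases le_total a b with hab | hab
  · exact key a b hab
  · rw [intervalIntegral.integral_symm, key b a hab, ← integral_neg]
    refine integral_congr_ae (Eventually.of_forall fun x => ?_)
    exact (intervalIntegral.integral_symm b a).symm

theorem intervalIntegral_triangle_swap {g : ℝ → ℝ → ℝ} (hg : Continuous (Function.uncurry g))
    {t : ℝ} (ht : 0 ≤ t) :
    ∫ s in (0 : ℝ)..t, ∫ r in s..t, g s r = ∫ r in (0 : ℝ)..t, ∫ s in (0 : ℝ)..r, g s r := by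
  set F : ℝ → ℝ → ℝ := fun s r => {p : ℝ × ℝ | p.1 < p.2}.indicator (Function.uncurry g) (s, r)
    with hF
  have hmeas : MeasurableSet {p : ℝ × ℝ | p.1 < p.2} :=
    measurableSet_lt measurable_fst measurable_snd
  have hint : Integrable (Function.uncurry F)
      ((volume.restrict (Ioc 0 t)).prod (volume.restrict (Ioc 0 t))) := by
    have h1 : IntegrableOn (Function.uncurry g) (Icc 0 t ×ˢ Icc 0 t) (volume.prod volume) :=
      hg.continuousOn.integrableOn_compact (isCompact_Icc.prod isCompact_Icc)
    have h2 := h1.mono_set (prod_mono (Ioc_subset_Icc_self (a := (0:ℝ)) (b := t))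
      (Ioc_subset_Icc_self (a := (0:ℝ)) (b := t)))
    rw [IntegrableOn, ← Measure.prod_restrict] at h2
    exact h2.indicator hmeas
  have hswap := integral_integral_swap hint
  simp only [intervalIntegral.integral_of_le ht]
  have e1 : ∫ s in Ioc 0 t, ∫ r in s..t, g s r = ∫ s in Ioc 0 t, ∫ r in Ioc 0 t, F s r := by
    refine setIntegral_congr_fun measurableSet_Ioc fun s hs => ?_
    simp only [intervalIntegral.integral_of_le hs.2]
    have : (fun r => F s r) = (Ioi s).indicator (g s) := by
      ext r; simp [hF, indicator, Function.uncurry]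
    rw [this, setIntegral_indicator measurableSet_Ioi]
    congr 2
    ext r
    simp only [mem_Ioc, mem_inter_iff, mem_Ioi]
    exact ⟨fun h => ⟨⟨hs.1.trans h.1, h.2⟩, h.1⟩, fun h => ⟨h.2, h.1.2⟩⟩
  have e2 : ∫ r in Ioc 0 t, ∫ s in (0:ℝ)..r, g s r = ∫ r in Ioc 0 t, ∫ s in Ioc 0 t, F s r := by
    refine setIntegral_congr_fun measurableSet_Ioc fun r hr => ?_
    simp only [intervalIntegral.integral_of_le hr.1.le]
    have : (fun s => F s r) = (Iio r).indicator (fun s => g s r) := by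
      ext s; simp [hF, indicator, Function.uncurry]
    rw [this, setIntegral_indicator measurableSet_Iio, integral_Ioc_eq_integral_Ioo]
    congr 2
    ext s
    simp only [mem_Ioo, mem_Ioc, mem_inter_iff, mem_Iio]
    exact ⟨fun h => ⟨⟨h.1, h.2.le.trans hr.2⟩, h.2⟩, fun h => ⟨h.1.1, h.2⟩⟩
  rw [e1, e2, hswap]

theorem WeakFamily.triangle_swap {H : ℝ → Measure ℝ} (hH : WeakFamily H)
    {f : ℝ → ℝ → ℝ → ℝ} (hf : Continuous fun p : ℝ × ℝ × ℝ => f p.1 p.2.1 p.2.2) {R : ℝ}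
    (hR : ∀ s r x, R < |x| → f s r x = 0) {t : ℝ} (ht : 0 ≤ t) :
    ∫ r in (0 : ℝ)..t, ∫ s in (0 : ℝ)..r, ∫ x, f s r x ∂(H s)
      = ∫ s in (0 : ℝ)..t, ∫ x, (∫ r in s..t, f s r x) ∂(H s) := by
  have hfin := hH.fin
  have hg : Continuous (Function.uncurry fun s r => ∫ x, f s r x ∂(H s)) := by
    refine hH.continuous_integral (P := ℝ × ℝ) (τ := fun p => p.1) continuous_fst
      (f := fun p x => f p.1 p.2 x) ?_ fun p₀ => ⟨R, Eventually.of_forall fun p x hx => hR _ _ _ hx⟩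
    exact hf.comp (by fun_prop : Continuous fun q : (ℝ × ℝ) × ℝ => (q.1.1, q.1.2, q.2))
  rw [← intervalIntegral_triangle_swap hg ht]
  congr 1
  ext s
  exact intervalIntegral_integral_swap (f := f s)
    (hf.comp (by fun_prop : Continuous fun q : ℝ × ℝ => (s, q.1, q.2))) (hR s) s t

/-- The integrating factor `exp(-∫_s^t A(X,ξ) dξ)`. -/
def damp (A : ℝ → ℝ → ℝ) (s t X : ℝ) : ℝ := exp (-(∫ ξ in s..t, A X ξ))

theorem continuous_damp {A : ℝ → ℝ → ℝ} (hA : Continuous (Function.uncurry A)) :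
    Continuous fun p : ℝ × ℝ × ℝ => damp A p.1 p.2.1 p.2.2 := by
  have hi : ∀ x a b, IntervalIntegrable (A x) volume a b := fun x a b =>
    (hA.comp (by fun_prop : Continuous fun ξ : ℝ => (x, ξ))).intervalIntegrable a b
  have e : ∀ p : ℝ × ℝ × ℝ, damp A p.1 p.2.1 p.2.2
      = exp (-((∫ ξ in (0:ℝ)..p.2.1, A p.2.2 ξ) - ∫ ξ in (0:ℝ)..p.1, A p.2.2 ξ)) := by
    intro p
    rw [damp, intervalIntegral.integral_interval_sub_left (hi _ _ _) (hi _ _ _)]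
  simp only [e]
  have hA' : Continuous (Function.uncurry fun (p : ℝ × ℝ × ℝ) ξ => A p.2.2 ξ) :=
    hA.comp (by fun_prop : Continuous fun q : (ℝ × ℝ × ℝ) × ℝ => (q.1.2.2, q.2))
  have h1 := intervalIntegral.continuous_parametric_intervalIntegral_of_continuous (μ := volume)
    (a₀ := 0) hA' (s := fun p => p.2.1) (by fun_prop)
  have h2 := intervalIntegral.continuous_parametric_intervalIntegral_of_continuous (μ := volume)
    (a₀ := 0) hA' (s := fun p => p.1) (by fun_prop)
  exact continuous_exp.comp (h1.sub h2).neg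

theorem damp_sub_damp {A A' : ℝ → ℝ → ℝ} (hA : Continuous (Function.uncurry A))
    (hA' : Continuous (Function.uncurry A')) (s t X : ℝ) :
    ∫ r in s..t, damp A s r X * ((A' X r - A X r) * damp A' r t X)
      = damp A s t X - damp A' s t X := by
  have hc : Continuous (A X) := hA.comp (by fun_prop : Continuous fun ξ : ℝ => (X, ξ))
  have hc' : Continuous (A' X) := hA'.comp (by fun_prop : Continuous fun ξ : ℝ => (X, ξ))
  have hd : ∀ r, HasDerivAt (fun r => damp A s r X) (damp A s r X * (-A X r)) r := fun r =>
    ((intervalIntegral.integral_hasDerivAt_right (hc.intervalIntegrable _ _)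
      hc.aestronglyMeasurable.stronglyMeasurableAtFilter hc.continuousAt).neg).exp
  have hd' : ∀ r, HasDerivAt (fun r => damp A' r t X) (damp A' r t X * (A' X r)) r := fun r => by
    have := ((intervalIntegral.integral_hasDerivAt_left (hc'.intervalIntegrable r t)
      hc'.aestronglyMeasurable.stronglyMeasurableAtFilter hc'.continuousAt).neg).exp
    rw [neg_neg] at this
    exact this
  have hcont : Continuous fun r => damp A s r X * ((A' X r - A X r) * damp A' r t X) := by
    have h1 : Continuous fun r => damp A s r X :=
      (continuous_damp hA).comp (by fun_prop : Continuous fun r : ℝ => (s, r, X))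
    have h2 : Continuous fun r => damp A' r t X :=
      (continuous_damp hA').comp (by fun_prop : Continuous fun r : ℝ => (r, t, X))
    fun_prop
  have hmain := intervalIntegral.integral_eq_sub_of_hasDerivAt
    (f := fun r => damp A s r X * damp A' r t X)
    (f' := fun r => damp A s r X * ((A' X r - A X r) * damp A' r t X)) (a := s) (b := t)
    (fun r _ => ((hd r).mul (hd' r)).congr_deriv (by ring)) (hcont.intervalIntegrable _ _)
  rw [hmain]
  simp [damp]

/-- The Duhamel representation with removal rate `A`, source `Q` and linear reaction `b`. -/
def Duhamel (A b : ℝ → ℝ → ℝ) (h0 : Measure ℝ) (Q H : ℝ → Measure ℝ) (T : ℝ) : Prop :=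
  ∀ t ∈ Icc (0:ℝ) T, ∀ φ : ℝ → ℝ, IsTest φ →
    ∫ X, φ X ∂(H t) = (∫ X, φ X * damp A 0 t X ∂h0)
      + ∫ s in (0:ℝ)..t, ((∫ X, φ X * damp A s t X ∂(Q s))
          + ∫ X, φ X * damp A s t X * b X s ∂(H s))

/-- Part of the removal rate may be moved to the reaction term. -/
theorem Duhamel.change_rate {A A' b : ℝ → ℝ → ℝ} {h0 : Measure ℝ} [IsFiniteMeasureOnCompacts h0]
    {Q H : ℝ → Measure ℝ} {T : ℝ} (hH : WeakFamily H) (hQ : WeakFamily Q)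
    (hA : Continuous (Function.uncurry A)) (hA' : Continuous (Function.uncurry A'))
    (hb : Continuous (Function.uncurry b)) (h : Duhamel A b h0 Q H T) :
    Duhamel A' (fun X s => b X s + (A' X s - A X s)) h0 Q H T := by
  intro t ht φ hφ
  have hfH := hH.fin
  have hfQ := hQ.fin
  obtain ⟨R, hR⟩ := hφ.supp
  have cA := continuous_damp hA
  have cA' := continuous_damp hA'
  have cφ := hφ.cont
  set ψ : ℝ → ℝ → ℝ := fun r X => φ X * ((A' X r - A X r) * damp A' r t X) with hψ
  have cψ : Continuous fun q : ℝ × ℝ => ψ q.1 q.2 := by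
    have h1 : Continuous fun q : ℝ × ℝ => A' q.2 q.1 := hA'.comp continuous_swap
    have h2 : Continuous fun q : ℝ × ℝ => A q.2 q.1 := hA.comp continuous_swap
    have h3 : Continuous fun q : ℝ × ℝ => damp A' q.1 t q.2 :=
      cA'.comp (by fun_prop : Continuous fun q : ℝ × ℝ => (q.1, t, q.2))
    exact (cφ.comp continuous_snd).mul ((h1.sub h2).mul h3)
  have ψR : ∀ r x, R < |x| → ψ r x = 0 := fun r x hx => by simp [hψ, hR x hx]
  have ψt : ∀ r, IsTest (ψ r) := fun r =>
    ⟨cψ.comp (by fun_prop : Continuous fun x : ℝ => (r, x)), R, ψR r⟩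
  have dc : ∀ s r, Continuous (damp A s r) := fun s r =>
    cA.comp (by fun_prop : Continuous fun x : ℝ => (s, r, x))
  have dc' : ∀ s r, Continuous (damp A' s r) := fun s r =>
    cA'.comp (by fun_prop : Continuous fun x : ℝ => (s, r, x))
  have bc : ∀ s, Continuous fun X => b X s := fun s =>
    hb.comp (by fun_prop : Continuous fun x : ℝ => (x, s))
  have c3 : Continuous fun p : ℝ × ℝ × ℝ => ψ p.2.1 p.2.2 * damp A p.1 p.2.1 p.2.2 :=
    (cψ.comp (by fun_prop : Continuous fun p : ℝ × ℝ × ℝ => (p.2.1, p.2.2))).mul cA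
  have c3b : Continuous fun p : ℝ × ℝ × ℝ =>
      ψ p.2.1 p.2.2 * damp A p.1 p.2.1 p.2.2 * b p.2.2 p.1 :=
    c3.mul (hb.comp (by fun_prop : Continuous fun p : ℝ × ℝ × ℝ => (p.2.2, p.1)))
  have pull : ∀ s x, ∫ r in s..t, ψ r x * damp A s r x = φ x * (damp A s t x - damp A' s t x) := by
    intro s x
    rw [← damp_sub_damp hA hA', ← intervalIntegral.integral_const_mul]
    congr 1
    ext r
    simp only [hψ]
    ring
  -- the three terms of the representation tested with `ψ r`, integrated in `r`
  have I0 : ∫ r in (0:ℝ)..t, ∫ X, ψ r X * damp A 0 r X ∂h0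
      = ∫ X, φ X * (damp A 0 t X - damp A' 0 t X) ∂h0 := by
    rw [intervalIntegral_integral_swap (f := fun r X => ψ r X * damp A 0 r X)
      (c3.comp (by fun_prop : Continuous fun q : ℝ × ℝ => ((0:ℝ), q.1, q.2))) (R := R)
      (fun r x hx => by simp [ψR r x hx])]
    simp only [pull]
  have IQ : ∫ r in (0:ℝ)..t, ∫ s in (0:ℝ)..r, ∫ X, ψ r X * damp A s r X ∂(Q s)
      = ∫ s in (0:ℝ)..t, ∫ X, φ X * (damp A s t X - damp A' s t X) ∂(Q s) := by
    rw [hQ.triangle_swap (f := fun s r X => ψ r X * damp A s r X) c3 (R := R)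
      (fun s r x hx => by simp [ψR r x hx]) ht.1]
    simp only [pull]
  have IH : ∫ r in (0:ℝ)..t, ∫ s in (0:ℝ)..r, ∫ X, ψ r X * damp A s r X * b X s ∂(H s)
      = ∫ s in (0:ℝ)..t, ∫ X, φ X * (damp A s t X - damp A' s t X) * b X s ∂(H s) := by
    rw [hH.triangle_swap (f := fun s r X => ψ r X * damp A s r X * b X s) c3b (R := R)
      (fun s r x hx => by simp [ψR r x hx]) ht.1]
    simp only [intervalIntegral.integral_mul_const, pull]
  -- continuity of the integrands
  have wk : ∀ {G : ℝ → Measure ℝ}, WeakFamily G → ∀ f : ℝ → ℝ → ℝ,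
      Continuous (Function.uncurry f) → Continuous fun s => ∫ X, φ X * f s X ∂(G s) := by
    intro G hG f hf
    refine hG.continuous_integral continuous_id (f := fun s X => φ X * f s X)
      ((cφ.comp continuous_snd).mul hf)
      fun p₀ => ⟨R, Eventually.of_forall fun p x hx => by simp [hR x hx]⟩
  have wk2 : ∀ {G : ℝ → Measure ℝ}, WeakFamily G → ∀ f : ℝ → ℝ → ℝ → ℝ,
      (Continuous fun p : ℝ × ℝ × ℝ => f p.1 p.2.1 p.2.2) → (∀ s r x, R < |x| → f s r x = 0) →
      Continuous fun q : ℝ × ℝ => ∫ X, f q.1 q.2 X ∂(G q.1) := by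
    intro G hG f hf hfR
    refine hG.continuous_integral (P := ℝ × ℝ) (τ := fun q => q.1) continuous_fst
      (f := fun q X => f q.1 q.2 X) ?_
      fun p₀ => ⟨R, Eventually.of_forall fun p x hx => hfR _ _ x hx⟩
    exact hf.comp (by fun_prop : Continuous fun q : (ℝ × ℝ) × ℝ => (q.1.1, q.1.2, q.2))
  have sA : Continuous (Function.uncurry fun s X => damp A s t X) :=
    cA.comp (by fun_prop : Continuous fun q : ℝ × ℝ => (q.1, t, q.2))
  have sA' : Continuous (Function.uncurry fun s X => damp A' s t X) :=
    cA'.comp (by fun_prop : Continuous fun q : ℝ × ℝ => (q.1, t, q.2))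
  have sb : Continuous (Function.uncurry fun s X => b X s) := hb.comp continuous_swap
  have hψint : ∫ r in (0:ℝ)..t, ∫ X, ψ r X ∂(H r)
      = (∫ X, φ X * (damp A 0 t X - damp A' 0 t X) ∂h0)
        + ((∫ s in (0:ℝ)..t, ∫ X, φ X * (damp A s t X - damp A' s t X) ∂(Q s))
        + ∫ s in (0:ℝ)..t, ∫ X, φ X * (damp A s t X - damp A' s t X) * b X s ∂(H s)) := by
    rw [← I0, ← IQ, ← IH]
    have kQ := wk2 hQ (fun s r X => ψ r X * damp A s r X) c3 fun s r x hx => by simp [ψR r x hx]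
    have kH := wk2 hH (fun s r X => ψ r X * damp A s r X * b X s) c3b
      fun s r x hx => by simp [ψR r x hx]
    have prim : ∀ {g : ℝ × ℝ → ℝ}, Continuous g →
        Continuous fun r => ∫ s in (0:ℝ)..r, g (s, r) := fun {g} hg =>
      intervalIntegral.continuous_parametric_intervalIntegral_of_continuous (μ := volume)
        (f := fun r s => g (s, r)) (hg.comp continuous_swap) continuous_id
    have k0 : Continuous fun r => ∫ X, ψ r X * damp A 0 r X ∂h0 :=
      (weakFamily_const h0).continuous_integral continuous_id
        (f := fun r X => ψ r X * damp A 0 r X)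
        (c3.comp (by fun_prop : Continuous fun q : ℝ × ℝ => ((0:ℝ), q.1, q.2)))
        fun p₀ => ⟨R, Eventually.of_forall fun p x hx => by simp [ψR p x hx]⟩
    have pQ : Continuous fun r => ∫ s in (0:ℝ)..r, ∫ X, ψ r X * damp A s r X ∂(Q s) := prim kQ
    have pH : Continuous fun r => ∫ s in (0:ℝ)..r, ∫ X, ψ r X * damp A s r X * b X s ∂(H s) :=
      prim kH
    rw [← intervalIntegral.integral_add (pQ.intervalIntegrable _ _)
      (pH.intervalIntegrable _ _), ← intervalIntegral.integral_add
      (k0.intervalIntegrable _ _) ((pQ.fun_add pH).intervalIntegrable _ _)]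
    refine intervalIntegral.integral_congr fun r hr => ?_
    rw [uIcc_of_le ht.1] at hr
    rw [h r ⟨hr.1, hr.2.trans ht.2⟩ (ψ r) (ψt r), intervalIntegral.integral_add]
    · exact (kQ.comp (by fun_prop : Continuous fun s : ℝ => (s, r))).intervalIntegrable _ _
    · exact (kH.comp (by fun_prop : Continuous fun s : ℝ => (s, r))).intervalIntegrable _ _
  have split0 : ∫ X, φ X * (damp A 0 t X - damp A' 0 t X) ∂h0
      = (∫ X, φ X * damp A 0 t X ∂h0) - ∫ X, φ X * damp A' 0 t X ∂h0 := by
    rw [← integral_sub ((hφ.mul_right (dc 0 t)).integrable _)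
      ((hφ.mul_right (dc' 0 t)).integrable _)]
    simp only [mul_sub]
  rw [split0] at hψint
  have hφt := h t ht φ hφ
  have hfinal : ∫ s in (0:ℝ)..t, ((∫ X, φ X * damp A' s t X ∂(Q s))
          + ∫ X, φ X * damp A' s t X * (b X s + (A' X s - A X s)) ∂(H s))
      = (∫ s in (0:ℝ)..t, ((∫ X, φ X * damp A s t X ∂(Q s))
          + ∫ X, φ X * damp A s t X * b X s ∂(H s)))
        - ((∫ s in (0:ℝ)..t, ∫ X, φ X * (damp A s t X - damp A' s t X) ∂(Q s))
        + ∫ s in (0:ℝ)..t, ∫ X, φ X * (damp A s t X - damp A' s t X) * b X s ∂(H s))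
        + ∫ r in (0:ℝ)..t, ∫ X, ψ r X ∂(H r) := by
    have a1 := wk hQ _ sA
    have a2 := wk hH (fun s X => damp A s t X * b X s) (sA.mul sb)
    have a3 := wk hQ (fun s X => damp A s t X - damp A' s t X) (sA.sub sA')
    have a4 := wk hH (fun s X => (damp A s t X - damp A' s t X) * b X s)
      ((sA.sub sA').mul sb)
    have a5 : Continuous fun r => ∫ X, ψ r X ∂(H r) :=
      hH.continuous_integral continuous_id cψ
        fun p₀ => ⟨R, Eventually.of_forall fun p x hx => ψR p x hx⟩
    simp only [← mul_assoc] at a2 a4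
    rw [← intervalIntegral.integral_add (a3.intervalIntegrable _ _) (a4.intervalIntegrable _ _),
      ← intervalIntegral.integral_sub ((a1.fun_add a2).intervalIntegrable _ _)
        ((a3.fun_add a4).intervalIntegrable _ _),
      ← intervalIntegral.integral_add
        (((a1.fun_add a2).fun_sub (a3.fun_add a4)).intervalIntegrable _ _)
        (a5.intervalIntegrable _ _)]
    congr 1
    ext s
    have tA := hφ.mul_right (dc s t)
    have tA' := hφ.mul_right (dc' s t)
    have q1 : ∫ X, φ X * (damp A s t X - damp A' s t X) ∂(Q s)
        = (∫ X, φ X * damp A s t X ∂(Q s)) - ∫ X, φ X * damp A' s t X ∂(Q s) := by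
      rw [← integral_sub (tA.integrable _) (tA'.integrable _)]
      simp only [mul_sub]
    have q2 : ∫ X, φ X * (damp A s t X - damp A' s t X) * b X s ∂(H s)
        = (∫ X, φ X * damp A s t X * b X s ∂(H s)) - ∫ X, φ X * damp A' s t X * b X s ∂(H s) := by
      rw [← integral_sub ((tA.mul_right (bc s)).integrable _)
        ((tA'.mul_right (bc s)).integrable _)]
      simp only [mul_sub, sub_mul]
    have q3 : ∫ X, φ X * damp A' s t X * (b X s + (A' X s - A X s)) ∂(H s)
        = (∫ X, φ X * damp A' s t X * b X s ∂(H s)) + ∫ X, ψ s X ∂(H s) := by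
      rw [← integral_add ((tA'.mul_right (bc s)).integrable _) ((ψt s).integrable _)]
      congr 1
      ext X
      simp only [hψ]
      ring
    rw [q1, q2, q3]
    ring
  rw [hfinal, hφt]
  linarith

/-- Time-dependent collision rates `k s Y Z` that are local, and dominated by a decreasing
weight `w`. -/
structure GoodRate (k : ℝ → ℝ → ℝ → ℝ) (w : ℝ → ℝ) (M c : ℝ) : Prop where
  w_cont : Continuous w
  w_pos : ∀ x, 0 < w x
  w_anti : AntitoneOn w (Ici 0)
  M_nonneg : 0 ≤ M
  c_nonneg : 0 ≤ c
  cont : Continuous fun p : ℝ × ℝ × ℝ => k p.1 p.2.1 p.2.2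
  nonneg : ∀ s Y Z, 0 ≤ k s Y Z
  supp : ∀ s Y Z, k s Y Z ≠ 0 → 0 < Y ∧ 0 < Z ∧ Z ≤ c * Y
  bound : ∀ s Y Z, 0 ≤ s → k s Y Z ≤ M * w Z

/-- The loss rate of particles of size `Y`. -/
def loss (k : ℝ → ℝ → ℝ → ℝ) (μ : Measure ℝ) (s Y : ℝ) : ℝ := ∫ Z, k s Y Z ∂μ

/-- The weak form of the coagulation operator. -/
def coag (k : ℝ → ℝ → ℝ → ℝ) (μ : Measure ℝ) (s : ℝ) (φ : ℝ → ℝ) : ℝ :=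
  ∫ Y, ∫ Z, k s Y Z * (φ (Y + Z) - φ Y) ∂μ ∂μ

/-- The measure of newly created particles. -/
def gain (k : ℝ → ℝ → ℝ → ℝ) (μ : Measure ℝ) (s : ℝ) : Measure ℝ :=
  Measure.map (fun p : ℝ × ℝ => p.1 + p.2)
    ((μ.prod μ).withDensity fun p => ENNReal.ofReal (k s p.1 p.2))

/-- Continuous functions of two variables, with a parameter, vanishing outside a fixed square. -/
structure IsTest₂ (g : ℝ → ℝ → ℝ → ℝ) : Prop where
  cont : Continuous fun p : ℝ × ℝ × ℝ => g p.1 p.2.1 p.2.2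
  supp : ∃ R : ℝ, ∀ s Y Z, (R < |Y| ∨ R < |Z|) → g s Y Z = 0

namespace IsTest₂

variable {g : ℝ → ℝ → ℝ → ℝ}

theorem cont₂ (hg : IsTest₂ g) (s : ℝ) : Continuous (Function.uncurry (g s)) :=
  hg.cont.comp (by fun_prop : Continuous fun q : ℝ × ℝ => (s, q.1, q.2))

theorem compact₂ (hg : IsTest₂ g) (s : ℝ) : HasCompactSupport (Function.uncurry (g s)) := by
  obtain ⟨R, hR⟩ := hg.supp
  refine HasCompactSupport.intro ((isCompact_Icc (a := -R) (b := R)).prod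
    (isCompact_Icc (a := -R) (b := R))) ?_
  rintro ⟨Y, Z⟩ hp
  refine hR s Y Z ?_
  by_contra! h
  exact hp ⟨abs_le.1 h.1, abs_le.1 h.2⟩

theorem integrable (hg : IsTest₂ g) (s : ℝ) (μ ν : Measure ℝ) [IsFiniteMeasureOnCompacts μ]
    [IsFiniteMeasureOnCompacts ν] : Integrable (Function.uncurry (g s)) (μ.prod ν) :=
  (hg.cont₂ s).integrable_of_hasCompactSupport (hg.compact₂ s)

theorem swap (hg : IsTest₂ g) : IsTest₂ fun s Y Z => g s Z Y := by
  obtain ⟨R, hR⟩ := hg.supp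
  exact ⟨hg.cont.comp (by fun_prop : Continuous fun p : ℝ × ℝ × ℝ => (p.1, p.2.2, p.2.1)),
    R, fun s Y Z h => hR s Z Y h.symm⟩

theorem right (hg : IsTest₂ g) (s Y : ℝ) : IsTest (g s Y) := by
  obtain ⟨R, hR⟩ := hg.supp
  exact ⟨hg.cont.comp (by fun_prop : Continuous fun z : ℝ => (s, Y, z)), R,
    fun x hx => hR s Y x (Or.inr hx)⟩

theorem continuous_inner (hg : IsTest₂ g) {H : ℝ → Measure ℝ} (hH : WeakFamily H) :
    Continuous fun q : ℝ × ℝ => ∫ Z, g q.1 q.2 Z ∂(H q.1) := by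
  obtain ⟨R, hR⟩ := hg.supp
  refine hH.continuous_integral (P := ℝ × ℝ) (τ := fun q => q.1) continuous_fst
    (f := fun q Z => g q.1 q.2 Z) ?_
    fun p₀ => ⟨R, Eventually.of_forall fun p x hx => hR _ _ x (Or.inr hx)⟩
  exact hg.cont.comp (by fun_prop : Continuous fun q : (ℝ × ℝ) × ℝ => (q.1.1, q.1.2, q.2))

theorem isTest_inner (hg : IsTest₂ g) (μ : Measure ℝ) [IsFiniteMeasureOnCompacts μ] (s : ℝ) :
    IsTest fun Y => ∫ Z, g s Y Z ∂μ := by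
  refine ⟨(hg.continuous_inner (weakFamily_const μ)).comp
    (by fun_prop : Continuous fun Y : ℝ => (s, Y)), ?_⟩
  obtain ⟨R, hR⟩ := hg.supp
  refine ⟨R, fun Y hY => ?_⟩
  simp [fun Z => hR s Y Z (Or.inl hY)]

theorem continuous_double (hg : IsTest₂ g) {H : ℝ → Measure ℝ} (hH : WeakFamily H) :
    Continuous fun s => ∫ Y, ∫ Z, g s Y Z ∂(H s) ∂(H s) := by
  obtain ⟨R, hR⟩ := hg.supp
  refine hH.continuous_integral continuous_id (f := fun s Y => ∫ Z, g s Y Z ∂(H s))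
    (hg.continuous_inner hH) fun p₀ => ⟨R, Eventually.of_forall fun p x hx => ?_⟩
  simp [fun Z => hR p x Z (Or.inl hx)]

theorem integral_swap (hg : IsTest₂ g) (s : ℝ) (μ ν : Measure ℝ) [IsFiniteMeasureOnCompacts μ]
    [IsFiniteMeasureOnCompacts ν] :
    ∫ Y, ∫ Z, g s Y Z ∂ν ∂μ = ∫ Z, ∫ Y, g s Y Z ∂μ ∂ν :=
  integral_integral_swap_of_hasCompactSupport (hg.cont₂ s) (hg.compact₂ s)

end IsTest₂

/-- `μ` and `ν` are `δ`-close in the total variation norm weighted by `w`. -/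
def Close (w : ℝ → ℝ) (δ : ℝ) (μ ν : Measure ℝ) : Prop :=
  ∀ K : ℝ, 0 ≤ K → ∀ φ : ℝ → ℝ, IsTest φ → (∀ x, |φ x| ≤ K * w x) →
    |(∫ X, φ X ∂μ) - ∫ X, φ X ∂ν| ≤ K * δ

namespace GoodRate

variable {k : ℝ → ℝ → ℝ → ℝ} {w : ℝ → ℝ} {M c : ℝ}

theorem isTest₂_sum (hk : GoodRate k w M c) {φ : ℝ → ℝ} (hφ : IsTest φ) :
    IsTest₂ fun s Y Z => k s Y Z * φ (Y + Z) := by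
  obtain ⟨R, hR⟩ := hφ.supp
  refine ⟨hk.cont.mul (hφ.cont.comp (by fun_prop)), R, fun s Y Z h => ?_⟩
  by_cases hz : k s Y Z = 0
  · simp [hz]
  · obtain ⟨hY, hZ, -⟩ := hk.supp s Y Z hz
    rw [abs_of_pos hY, abs_of_pos hZ] at h
    rw [hR (Y + Z), mul_zero]
    rw [abs_of_pos (add_pos hY hZ)]
    rcases h with h | h <;> linarith

theorem isTest₂_left (hk : GoodRate k w M c) {φ : ℝ → ℝ} (hφ : IsTest φ) :
    IsTest₂ fun s Y Z => k s Y Z * φ Y := by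
  obtain ⟨R, hR⟩ := hφ.supp
  refine ⟨hk.cont.mul (hφ.cont.comp (by fun_prop)), max R (c * R), fun s Y Z h => ?_⟩
  by_cases hz : k s Y Z = 0
  · simp [hz]
  · obtain ⟨hY, hZ, hZY⟩ := hk.supp s Y Z hz
    rw [hR Y, mul_zero]
    rw [abs_of_pos hY, abs_of_pos hZ] at *
    rcases h with h | h
    · exact (le_max_left _ _).trans_lt h
    · by_contra! hYR
      have := mul_le_mul_of_nonneg_left hYR hk.c_nonneg
      have := le_max_right R (c * R)
      linarith

theorem isTest₂_diff (hk : GoodRate k w M c) {φ : ℝ → ℝ} (hφ : IsTest φ) :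
    IsTest₂ fun s Y Z => k s Y Z * (φ (Y + Z) - φ Y) := by
  obtain ⟨R, hR⟩ := (hk.isTest₂_sum hφ).supp
  obtain ⟨S, hS⟩ := (hk.isTest₂_left hφ).supp
  refine ⟨?_, max R S, fun s Y Z h => ?_⟩
  · have := (hk.isTest₂_sum hφ).cont.fun_sub (hk.isTest₂_left hφ).cont
    simpa only [mul_sub] using this
  · rw [mul_sub, hR s Y Z, hS s Y Z, sub_zero]
    · exact h.imp (le_max_right R S).trans_lt (le_max_right R S).trans_lt
    · exact h.imp (le_max_left R S).trans_lt (le_max_left R S).trans_lt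

theorem isTest_rate (hk : GoodRate k w M c) (s Y : ℝ) : IsTest (k s Y) := by
  refine ⟨hk.cont.comp (by fun_prop : Continuous fun z : ℝ => (s, Y, z)), c * Y, fun x hx => ?_⟩
  by_contra hz
  obtain ⟨hY, hZ, hZY⟩ := hk.supp s Y x hz
  rw [abs_of_pos hZ] at hx
  linarith

theorem continuous_loss (hk : GoodRate k w M c) {H : ℝ → Measure ℝ} (hH : WeakFamily H) :
    Continuous (Function.uncurry fun X s => loss k (H s) s X) := by
  refine hH.continuous_integral (P := ℝ × ℝ) (τ := fun q => q.2) continuous_snd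
    (f := fun q Z => k q.2 q.1 Z) ?_ fun p₀ => ⟨c * (p₀.1 + 1), ?_⟩
  · exact hk.cont.comp (by fun_prop : Continuous fun q : (ℝ × ℝ) × ℝ => (q.1.2, q.1.1, q.2))
  · have : ∀ᶠ p : ℝ × ℝ in 𝓝 p₀, p.1 < p₀.1 + 1 :=
      continuous_fst.continuousAt.eventually (gt_mem_nhds (lt_add_one _))
    filter_upwards [this] with p hp x hx
    by_contra hz
    obtain ⟨hY, hZ, hZY⟩ := hk.supp p.2 p.1 x hz
    rw [abs_of_pos hZ] at hx
    have := mul_le_mul_of_nonneg_left hp.le hk.c_nonneg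
    linarith

theorem loss_le (hk : GoodRate k w M c) {μ : Measure ℝ} [IsFiniteMeasureOnCompacts μ]
    (hw : Integrable w μ) {s : ℝ} (hs : 0 ≤ s) (Y : ℝ) : loss k μ s Y ≤ M * ∫ X, w X ∂μ := by
  rw [← integral_const_mul]
  exact integral_mono ((hk.isTest_rate s Y).integrable μ) (hw.const_mul M)
    fun Z => hk.bound s Y Z hs

theorem integral_gain (hk : GoodRate k w M c) (μ : Measure ℝ) [IsFiniteMeasureOnCompacts μ]
    (s : ℝ) {φ : ℝ → ℝ} (hφ : IsTest φ) :
    ∫ X, φ X ∂(gain k μ s) = ∫ Y, ∫ Z, k s Y Z * φ (Y + Z) ∂μ ∂μ := by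
  have hkm : Measurable fun p : ℝ × ℝ => k s p.1 p.2 :=
    (hk.cont.comp (by fun_prop : Continuous fun q : ℝ × ℝ => (s, q.1, q.2))).measurable
  rw [gain, integral_map (by fun_prop) hφ.cont.aestronglyMeasurable,
    integral_withDensity_eq_integral_toReal_smul hkm.ennreal_ofReal
      (Eventually.of_forall fun _ => ENNReal.ofReal_lt_top)]
  simp only [ENNReal.toReal_ofReal (hk.nonneg _ _ _), smul_eq_mul]
  exact integral_prod _ ((hk.isTest₂_sum hφ).integrable s μ μ)

theorem isFiniteMeasureOnCompacts_gain (hk : GoodRate k w M c) (μ : Measure ℝ)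
    [IsFiniteMeasureOnCompacts μ] (s : ℝ) : IsFiniteMeasureOnCompacts (gain k μ s) := by
  refine ⟨fun K hK => ?_⟩
  have hkm : Measurable fun p : ℝ × ℝ => k s p.1 p.2 :=
    (hk.cont.comp (by fun_prop : Continuous fun q : ℝ × ℝ => (s, q.1, q.2))).measurable
  obtain ⟨R, hR⟩ := hK.isBounded.subset_closedBall 0
  have hpl : ∀ x ∈ K, plateau R x = 1 := fun x hx => plateau_eq_one (by
    simpa [Metric.mem_closedBall, dist_zero_right] using hR hx)
  have hmeas : MeasurableSet ((fun p : ℝ × ℝ => p.1 + p.2) ⁻¹' K) :=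
    (hK.measurableSet).preimage (by fun_prop)
  rw [gain, Measure.map_apply (by fun_prop) hK.measurableSet, withDensity_apply _ hmeas]
  calc _ ≤ ∫⁻ p, ENNReal.ofReal (k s p.1 p.2 * plateau R (p.1 + p.2)) ∂(μ.prod μ) := by
        rw [← lintegral_indicator hmeas]
        refine lintegral_mono fun p => ?_
        by_cases hp : p ∈ (fun p : ℝ × ℝ => p.1 + p.2) ⁻¹' K
        · rw [indicator_of_mem hp, hpl _ hp, mul_one]
        · rw [indicator_of_notMem hp]
          exact zero_le
    _ < ⊤ := ((hk.isTest₂_sum (isTest_plateau R)).integrable s μ μ).lintegral_lt_top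

theorem weakFamily_gain (hk : GoodRate k w M c) {H : ℝ → Measure ℝ} (hH : WeakFamily H) :
    WeakFamily fun s => gain k (H s) s := by
  have := hH.fin
  refine ⟨fun s => hk.isFiniteMeasureOnCompacts_gain _ s, fun φ hφ => ?_⟩
  simp only [hk.integral_gain _ _ hφ]
  exact (hk.isTest₂_sum hφ).continuous_double hH

theorem continuous_coag (hk : GoodRate k w M c) {H : ℝ → Measure ℝ} (hH : WeakFamily H)
    {φ : ℝ → ℝ} (hφ : IsTest φ) : Continuous fun s => coag k (H s) s φ :=
  (hk.isTest₂_diff hφ).continuous_double hH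

theorem isTest_mul_loss (hk : GoodRate k w M c) (μ : Measure ℝ) [IsFiniteMeasureOnCompacts μ]
    (s : ℝ) {φ : ℝ → ℝ} (hφ : IsTest φ) : IsTest fun X => φ X * loss k μ s X :=
  hφ.mul_right ((hk.continuous_loss (weakFamily_const μ)).comp
    (by fun_prop : Continuous fun X : ℝ => (X, s)))

theorem coag_eq (hk : GoodRate k w M c) (μ : Measure ℝ) [IsFiniteMeasureOnCompacts μ]
    (s : ℝ) {φ : ℝ → ℝ} (hφ : IsTest φ) :
    coag k μ s φ = (∫ X, φ X ∂(gain k μ s)) - ∫ X, φ X * loss k μ s X ∂μ := by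
  rw [hk.integral_gain μ s hφ, ← integral_sub
    (((hk.isTest₂_sum hφ).isTest_inner μ s).integrable μ)
    ((hk.isTest_mul_loss μ s hφ).integrable μ), coag]
  congr 1
  ext Y
  rw [loss, ← integral_const_mul, ← integral_sub
    (((hk.isTest₂_sum hφ).right s Y).integrable μ)
    (((hk.isTest_rate s Y).const_mul _).integrable μ)]
  congr 1
  ext Z
  ring

theorem coag_nonpos (hk : GoodRate k w M c) (μ : Measure ℝ) (s : ℝ) {φ : ℝ → ℝ}
    (hφ : AntitoneOn φ (Ici 0)) : coag k μ s φ ≤ 0 := by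
  refine integral_nonpos fun Y => integral_nonpos fun Z => ?_
  by_cases hz : k s Y Z = 0
  · simp [hz]
  · obtain ⟨hY, hZ, -⟩ := hk.supp s Y Z hz
    refine mul_nonpos_of_nonneg_of_nonpos (hk.nonneg _ _ _) (sub_nonpos.2 ?_)
    exact hφ hY.le (add_pos hY hZ).le (by linarith)

/-- The weak coagulation operator is Lipschitz for the weighted total variation distance. -/
theorem abs_coag_sub_le (hk : GoodRate k w M c) {μ ν : Measure ℝ} [IsFiniteMeasureOnCompacts μ]
    [IsFiniteMeasureOnCompacts ν] (hμ : Integrable w μ) (hν : Integrable w ν) {B δ : ℝ}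
    (hμB : ∫ X, w X ∂μ ≤ B) (hνB : ∫ X, w X ∂ν ≤ B) (hδ : Close w δ μ ν)
    {s : ℝ} (hs : 0 ≤ s) {φ : ℝ → ℝ} (hφ : IsTest φ) {K : ℝ} (hK : 0 ≤ K)
    (hφK : ∀ x, |φ x| ≤ K * w x) :
    |coag k μ s φ - coag k ν s φ| ≤ K * (4 * M * B * δ) := by
  have hg := hk.isTest₂_diff hφ
  have hB : 0 ≤ B := (integral_nonneg fun x => (hk.w_pos x).le).trans hμB
  have hpt : ∀ Y Z, |k s Y Z * (φ (Y + Z) - φ Y)| ≤ 2 * K * M * w Y * w Z := by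
    intro Y Z
    have hwY := (hk.w_pos Y).le
    have hwZ := (hk.w_pos Z).le
    have hM := hk.M_nonneg
    by_cases hz : k s Y Z = 0
    · simp only [hz, zero_mul, abs_zero]
      positivity
    · obtain ⟨hY, hZ, -⟩ := hk.supp s Y Z hz
      have h1 : w (Y + Z) ≤ w Y := hk.w_anti hY.le (add_pos hY hZ).le (by linarith)
      have h2 : |φ (Y + Z) - φ Y| ≤ 2 * K * w Y := by
        have := abs_sub (φ (Y + Z)) (φ Y)
        have := hφK (Y + Z)
        have := hφK Y
        have := mul_le_mul_of_nonneg_left h1 hK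
        linarith
      rw [abs_mul, abs_of_nonneg (hk.nonneg _ _ _)]
      calc _ ≤ (M * w Z) * (2 * K * w Y) :=
            mul_le_mul (hk.bound s Y Z hs) h2 (abs_nonneg _) (by positivity)
        _ = _ := by ring
  have b1 : ∀ Y, |∫ Z, k s Y Z * (φ (Y + Z) - φ Y) ∂μ| ≤ 2 * K * M * B * w Y := by
    intro Y
    have : ‖∫ Z, k s Y Z * (φ (Y + Z) - φ Y) ∂μ‖ ≤ ∫ Z, 2 * K * M * w Y * w Z ∂μ :=
      norm_integral_le_of_norm_le (hμ.const_mul _) (Eventually.of_forall fun Z => hpt Y Z)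
    rw [integral_const_mul] at this
    have h0 : 0 ≤ 2 * K * M * w Y := by
      have := (hk.w_pos Y).le; have := hk.M_nonneg; positivity
    have := mul_le_mul_of_nonneg_left hμB h0
    rw [norm_eq_abs] at *
    linarith
  have b2 : ∀ Z, |∫ Y, k s Y Z * (φ (Y + Z) - φ Y) ∂ν| ≤ 2 * K * M * B * w Z := by
    intro Z
    have : ‖∫ Y, k s Y Z * (φ (Y + Z) - φ Y) ∂ν‖ ≤ ∫ Y, 2 * K * M * w Z * w Y ∂ν :=
      norm_integral_le_of_norm_le (hν.const_mul _) (Eventually.of_forall fun Y => by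
        rw [norm_eq_abs]
        exact (hpt Y Z).trans (by linarith))
    rw [integral_const_mul] at this
    have h0 : 0 ≤ 2 * K * M * w Z := by
      have := (hk.w_pos Z).le; have := hk.M_nonneg; positivity
    have := mul_le_mul_of_nonneg_left hνB h0
    rw [norm_eq_abs] at *
    linarith
  have hK' : 0 ≤ 2 * K * M * B := by have := hk.M_nonneg; positivity
  have e1 := hδ _ hK' _ (hg.isTest_inner μ s) b1
  have e2 := hδ _ hK' _ (hg.swap.isTest_inner ν s) b2
  rw [← hg.integral_swap s ν μ, ← hg.integral_swap s ν ν] at e2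
  have : coag k μ s φ - coag k ν s φ
      = ((∫ Y, ∫ Z, k s Y Z * (φ (Y + Z) - φ Y) ∂μ ∂μ)
          - ∫ Y, ∫ Z, k s Y Z * (φ (Y + Z) - φ Y) ∂μ ∂ν)
        + ((∫ Y, ∫ Z, k s Y Z * (φ (Y + Z) - φ Y) ∂μ ∂ν)
          - ∫ Y, ∫ Z, k s Y Z * (φ (Y + Z) - φ Y) ∂ν ∂ν) := by
    rw [coag, coag]; ring
  rw [this]
  refine (abs_add_le _ _).trans ?_
  linarith

end GoodRate

theorem measure_Iio_zero_iff {μ : Measure ℝ} : μ (Iio 0) = 0 ↔ ∀ᵐ x ∂μ, 0 ≤ x := by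
  rw [ae_iff]
  simp only [not_le]
  rfl

/-- `μ` charges decreasing test functions at most `L` times as much as `ν` does. -/
def Spread (L : ℝ) (μ ν : Measure ℝ) : Prop :=
  ∀ φ : ℝ → ℝ, IsTest φ → (∀ x, 0 ≤ φ x) → AntitoneOn φ (Ici 0) →
    ∫ X, φ X ∂μ ≤ L * ∫ X, φ X ∂ν

namespace Spread

variable {L : ℝ} {μ ν : Measure ℝ} [IsFiniteMeasureOnCompacts μ]

theorem measure_Iio (h : Spread L μ ν) (hν : ν (Iio 0) = 0) : μ (Iio 0) = 0 := by
  have hae : ∀ᵐ x ∂ν, 0 ≤ x := measure_Iio_zero_iff.1 hν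
  have key : ∀ n : ℕ, ∀ᵐ x ∂μ, plateau n x * max 0 (-x) = 0 := by
    intro n
    have ht : IsTest fun x => plateau n x * max 0 (-x) :=
      (isTest_plateau n).mul_right (by fun_prop)
    have hnn : ∀ x, 0 ≤ plateau n x * max 0 (-x) := fun x =>
      mul_nonneg (plateau_nonneg _ _) (le_max_left _ _)
    have hz : ∀ x ∈ Ici (0:ℝ), plateau n x * max 0 (-x) = 0 := fun x hx => by
      rw [max_eq_left (neg_nonpos.2 hx), mul_zero]
    have hle := h _ ht hnn fun x hx y hy _ => by
      show plateau n y * max 0 (-y) ≤ plateau n x * max 0 (-x)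
      rw [hz x hx, hz y hy]
    rw [integral_eq_zero_of_ae (hae.mono hz), mul_zero] at hle
    exact (integral_eq_zero_iff_of_nonneg hnn (ht.integrable μ)).1
      (le_antisymm hle (integral_nonneg hnn))
  rw [measure_Iio_zero_iff]
  filter_upwards [ae_all_iff.2 key] with x hx
  obtain ⟨n, hn⟩ := exists_nat_ge |x|
  have := hx n
  rw [plateau_eq_one hn, one_mul] at this
  have := le_max_right 0 (-x)
  linarith

theorem integrable_weight [IsFiniteMeasureOnCompacts ν] (h : Spread L μ ν) (hL : 0 ≤ L)
    {w : ℝ → ℝ} (hwc : Continuous w) (hwn : ∀ x, 0 ≤ w x) (hwa : AntitoneOn w (Ici 0))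
    (hwν : Integrable w ν) :
    Integrable w μ ∧ ∫ X, w X ∂μ ≤ L * ∫ X, w X ∂ν := by
  have hI : 0 ≤ L * ∫ X, w X ∂ν := mul_nonneg hL (integral_nonneg hwn)
  have hb : ∀ n : ℕ, ∫⁻ x, ENNReal.ofReal (plateau n x * w x) ∂μ
      ≤ ENNReal.ofReal (L * ∫ X, w X ∂ν) := by
    intro n
    have ht : IsTest fun x => plateau n x * w x := (isTest_plateau n).mul_right hwc
    have hnn : ∀ x, 0 ≤ plateau n x * w x := fun x => mul_nonneg (plateau_nonneg _ _) (hwn x)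
    rw [← ofReal_integral_eq_lintegral_ofReal (ht.integrable μ) (Eventually.of_forall hnn)]
    refine ENNReal.ofReal_le_ofReal ((h _ ht hnn ?_).trans ?_)
    · intro x hx y hy hxy
      exact mul_le_mul (plateau_antitoneOn _ hx hy hxy) (hwa hx hy hxy) (hwn y)
        (plateau_nonneg _ _)
    · refine mul_le_mul_of_nonneg_left (integral_mono (ht.integrable ν) hwν fun x => ?_) hL
      exact mul_le_of_le_one_left (hwn x) (plateau_le_one _ _)
  have hlim : ∫⁻ x, ENNReal.ofReal (w x) ∂μ ≤ ENNReal.ofReal (L * ∫ X, w X ∂ν) := by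
    have hfat := lintegral_liminf_le (μ := μ) (u := atTop)
      (f := fun (n : ℕ) x => ENNReal.ofReal (plateau n x * w x))
      fun n => (((continuous_plateau n).mul hwc).measurable).ennreal_ofReal
    have hpt : ∀ x, liminf (fun n : ℕ => ENNReal.ofReal (plateau n x * w x)) atTop
        = ENNReal.ofReal (w x) := by
      intro x
      refine Tendsto.liminf_eq (tendsto_const_nhds.congr' ?_)
      obtain ⟨m, hm⟩ := exists_nat_ge |x|
      filter_upwards [eventually_ge_atTop m] with n hn
      rw [plateau_eq_one (hm.trans (by exact_mod_cast hn)), one_mul]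
    simp only [hpt] at hfat
    refine hfat.trans ?_
    refine liminf_le_of_le (by isBoundedDefault) fun b hb' => ?_
    obtain ⟨n, hn⟩ := hb'.exists
    exact hn.trans (hb n)
  have hint : Integrable w μ := by
    refine ⟨hwc.aestronglyMeasurable, ?_⟩
    rw [hasFiniteIntegral_iff_ofReal (Eventually.of_forall hwn)]
    exact hlim.trans_lt ENNReal.ofReal_lt_top
  refine ⟨hint, ?_⟩
  rw [← ofReal_integral_eq_lintegral_ofReal hint (Eventually.of_forall hwn)] at hlim
  exact (ENNReal.ofReal_le_ofReal_iff hI).1 hlim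

theorem measure_Icc_le [IsFiniteMeasureOnCompacts ν] (h : Spread L μ ν) (hL : 0 ≤ L)
    (hν : ν (Iio 0) = 0)
    {R δ : ℝ} (hδ : 0 < δ) :
    μ (Icc 0 R) ≤ ENNReal.ofReal L * ν (Icc 0 (R + δ)) := by
  set φ : ℝ → ℝ := fun x => max 0 (min 1 ((R + δ - |x|) / δ)) with hφ
  have ht : IsTest φ := by
    refine ⟨by fun_prop, R + δ, fun x hx => ?_⟩
    rw [hφ]
    exact max_eq_left ((min_le_right _ _).trans
      (div_nonpos_of_nonpos_of_nonneg (by linarith) hδ.le))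
  have hnn : ∀ x, 0 ≤ φ x := fun x => le_max_left _ _
  have hle1 : ∀ x, φ x ≤ 1 := fun x => max_le zero_le_one (min_le_left _ _)
  have hanti : AntitoneOn φ (Ici 0) := by
    intro x hx y hy hxy
    simp only [hφ]
    rw [abs_of_nonneg (show 0 ≤ x from hx), abs_of_nonneg (show 0 ≤ y from hy)]
    gcongr
  have hone : ∀ x ∈ Icc (0:ℝ) R, 1 ≤ φ x := by
    intro x hx
    refine le_max_of_le_right (le_min le_rfl ?_)
    rw [le_div_iff₀ hδ, abs_of_nonneg hx.1]
    linarith [hx.2]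
  have hae : ∀ᵐ x ∂ν, 0 ≤ x := measure_Iio_zero_iff.1 hν
  have h1 : μ (Icc 0 R) ≤ ENNReal.ofReal (∫ x, φ x ∂μ) := by
    rw [ofReal_integral_eq_lintegral_ofReal (ht.integrable μ) (Eventually.of_forall hnn),
      ← lintegral_indicator_one measurableSet_Icc]
    refine lintegral_mono fun x => ?_
    by_cases hx : x ∈ Icc 0 R
    · rw [indicator_of_mem hx]
      simpa using ENNReal.ofReal_le_ofReal (hone x hx)
    · rw [indicator_of_notMem hx]
      exact zero_le
  have h2 : ENNReal.ofReal (∫ x, φ x ∂ν) ≤ ν (Icc 0 (R + δ)) := by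
    rw [ofReal_integral_eq_lintegral_ofReal (ht.integrable ν) (Eventually.of_forall hnn),
      ← lintegral_indicator_one measurableSet_Icc]
    refine lintegral_mono_ae (hae.mono fun x hx0 => ?_)
    by_cases hx : x ∈ Icc 0 (R + δ)
    · rw [indicator_of_mem hx]
      simpa using ENNReal.ofReal_le_ofReal (hle1 x)
    · rw [indicator_of_notMem hx, ENNReal.ofReal_eq_zero.2]
      refine max_le le_rfl ((min_le_right _ _).trans
        (div_nonpos_of_nonpos_of_nonneg ?_ hδ.le))
      rw [abs_of_nonneg hx0]
      by_contra! hc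
      exact hx ⟨hx0, by linarith⟩
  refine h1.trans ((ENNReal.ofReal_le_ofReal (h φ ht hnn hanti)).trans ?_)
  rw [ENNReal.ofReal_mul hL]
  gcongr

theorem growth_bound [IsFiniteMeasureOnCompacts ν] (h : Spread L μ ν) (hL : 0 ≤ L)
    (hν : ν (Iio 0) = 0) {M a : ℝ}
    (hM : ∀ R > (0:ℝ), ν (Icc 0 R) ≤ ENNReal.ofReal (M * R ^ a)) :
    ∀ R > (0:ℝ), μ (Icc 0 R) ≤ ENNReal.ofReal (M * L * R ^ a) := by
  intro R hR
  have hlim : Tendsto (fun δ : ℝ => ENNReal.ofReal (M * L * (R + δ) ^ a)) (𝓝[>] 0)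
      (𝓝 (ENNReal.ofReal (M * L * R ^ a))) := by
    refine (ENNReal.continuous_ofReal.tendsto _).comp (Tendsto.const_mul _ ?_)
    have hc : ContinuousAt (fun δ : ℝ => (R + δ) ^ a) 0 :=
      ContinuousAt.rpow_const (by fun_prop) (Or.inl (by linarith))
    have := hc.tendsto
    rw [add_zero] at this
    exact this.mono_left nhdsWithin_le_nhds
  refine ge_of_tendsto hlim ?_
  filter_upwards [self_mem_nhdsWithin] with δ hδ
  have hδ' : 0 < δ := hδ
  refine (h.measure_Icc_le hL hν hδ').trans ?_
  calc _ ≤ ENNReal.ofReal L * ENNReal.ofReal (M * (R + δ) ^ a) := by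
        gcongr
        exact hM _ (by linarith)
    _ = ENNReal.ofReal (M * L * (R + δ) ^ a) := by
        rw [← ENNReal.ofReal_mul hL]
        congr 1
        ring

end Spread

theorem MemX.isFiniteMeasureOnCompacts {ρ : ℝ} {μ : Measure ℝ} (h : MemX ρ μ) :
    IsFiniteMeasureOnCompacts μ := by
  refine ⟨fun K hK => ?_⟩
  obtain ⟨h0, M, hM⟩ := h
  obtain ⟨R, hR⟩ := hK.isBounded.subset_closedBall 0
  have hsub : K ⊆ Iio 0 ∪ Icc 0 (max R 1) := by
    intro x hx
    have := hR hx
    rw [Metric.mem_closedBall, dist_zero_right, norm_eq_abs, abs_le] at this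
    rcases lt_or_ge x 0 with h | h
    · exact Or.inl h
    · exact Or.inr ⟨h, this.2.trans (le_max_left _ _)⟩
  calc μ K ≤ μ (Iio 0) + μ (Icc 0 (max R 1)) := (measure_mono hsub).trans (measure_union_le _ _)
    _ < ⊤ := by
      rw [h0, zero_add]
      exact (hM _ (lt_max_of_lt_right one_pos)).trans_lt ENNReal.ofReal_lt_top

theorem MemX.of_spread {ρ L : ℝ} {μ ν : Measure ℝ} [IsFiniteMeasureOnCompacts μ]
    (hν : MemX ρ ν) (hL : 0 ≤ L) (h : Spread L μ ν) : MemX ρ μ := by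
  have := hν.isFiniteMeasureOnCompacts
  obtain ⟨M, hM⟩ := hν.2
  exact ⟨h.measure_Iio hν.1, M * L, h.growth_bound hL hν.1 hM⟩

theorem Xnorm_le_of_spread {ρ L : ℝ} {μ ν : Measure ℝ} [IsFiniteMeasureOnCompacts μ]
    (hν : MemX ρ ν) (hL : 0 < L) (h : Spread L μ ν) : Xnorm ρ μ ≤ Xnorm ρ ν * L := by
  have := hν.isFiniteMeasureOnCompacts
  rw [← div_le_iff₀ hL]
  refine le_csInf ?_ ?_
  · obtain ⟨M, hM⟩ := hν.2
    refine ⟨max M 0, le_max_right _ _, fun R hR => (hM R hR).trans ?_⟩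
    gcongr
    exact le_max_left _ _
  · rintro M ⟨hM0, hM⟩
    rw [div_le_iff₀ hL]
    exact csInf_le ⟨0, fun x hx => hx.1⟩ ⟨mul_nonneg hM0 hL.le, h.growth_bound hL.le hν.1 hM⟩

/-- A positive linear functional on test functions is represented by a measure. -/
theorem exists_measure_of_functional (J : (ℝ → ℝ) → ℝ)
    (hadd : ∀ φ ψ, IsTest φ → IsTest ψ → J (fun x => φ x + ψ x) = J φ + J ψ)
    (hmul : ∀ a φ, IsTest φ → J (fun x => a * φ x) = a * J φ)
    (hpos : ∀ φ, IsTest φ → (∀ x, 0 ≤ φ x) → 0 ≤ J φ) :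
    ∃ μ : Measure ℝ, IsFiniteMeasureOnCompacts μ ∧ ∀ φ, IsTest φ → ∫ X, φ X ∂μ = J φ := by
  have ht : ∀ f : CompactlySupportedContinuousMap ℝ ℝ, IsTest f := fun f =>
    isTest_iff.2 ⟨f.continuous, f.hasCompactSupport⟩
  let Λ : CompactlySupportedContinuousMap ℝ ℝ →ₚ[ℝ] ℝ := PositiveLinearMap.mk₀
    { toFun := fun f => J f
      map_add' := fun f g => hadd f g (ht f) (ht g)
      map_smul' := fun a f => hmul a f (ht f) } fun f hf => hpos f (ht f) fun x => hf x
  refine ⟨RealRMK.rieszMeasure Λ, inferInstance, fun φ hφ => ?_⟩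
  obtain ⟨hc, hs⟩ := isTest_iff.1 hφ
  exact RealRMK.integral_rieszMeasure Λ ⟨⟨φ, hc⟩, hs⟩

theorem measure_eq_of_integral_eq {μ ν : Measure ℝ} [IsFiniteMeasureOnCompacts μ]
    [IsFiniteMeasureOnCompacts ν] (h : ∀ φ, IsTest φ → ∫ X, φ X ∂μ = ∫ X, φ X ∂ν) : μ = ν :=
  Measure.ext_of_integral_eq_on_compactlySupported fun f =>
    h f (isTest_iff.2 ⟨f.continuous, f.hasCompactSupport⟩)

theorem IsTest.exists_le_weight {φ w : ℝ → ℝ} (hφ : IsTest φ) (hw : Continuous w)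
    (hw0 : ∀ x, 0 < w x) : ∃ K : ℝ, 0 ≤ K ∧ ∀ x, |φ x| ≤ K * w x := by
  have ht : IsTest fun x => φ x * (w x)⁻¹ := hφ.mul_right (hw.inv₀ fun x => (hw0 x).ne')
  obtain ⟨K, hK⟩ := (isTest_iff.1 ht).2.exists_bound_of_continuous ht.cont
  refine ⟨K, (norm_nonneg _).trans (hK 0), fun x => ?_⟩
  have := hK x
  rwa [norm_mul, norm_inv, norm_eq_abs, norm_eq_abs, abs_of_pos (hw0 x), ← div_eq_mul_inv,
    div_le_iff₀ (hw0 x)] at this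

/-- The Picard map of the coagulation equation with linear growth rate `κ`, in weak form; the
constant `Λ` is an artificial removal rate, added to make the map positive. -/
def picard (k : ℝ → ℝ → ℝ → ℝ) (Λ κ : ℝ) (h0 : Measure ℝ) (H : ℝ → Measure ℝ) (t : ℝ)
    (φ : ℝ → ℝ) : ℝ :=
  exp ((κ - Λ) * t) * (∫ X, φ X ∂h0)
    + ∫ s in (0:ℝ)..t, exp ((κ - Λ) * (t - s)) * (coag k (H s) s φ + Λ * ∫ X, φ X ∂(H s))

namespace GoodRate

variable {k : ℝ → ℝ → ℝ → ℝ} {w : ℝ → ℝ} {M c : ℝ}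

theorem coag_add (hk : GoodRate k w M c) (μ : Measure ℝ) [IsFiniteMeasureOnCompacts μ] (s : ℝ)
    {φ ψ : ℝ → ℝ} (hφ : IsTest φ) (hψ : IsTest ψ) :
    coag k μ s (fun x => φ x + ψ x) = coag k μ s φ + coag k μ s ψ := by
  have := hk.isFiniteMeasureOnCompacts_gain μ s
  rw [hk.coag_eq μ s (hφ.add hψ), hk.coag_eq μ s hφ, hk.coag_eq μ s hψ,
    integral_add (hφ.integrable _) (hψ.integrable _)]
  simp only [add_mul]
  rw [integral_add ((hk.isTest_mul_loss μ s hφ).integrable _)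
    ((hk.isTest_mul_loss μ s hψ).integrable _)]
  ring

theorem coag_const_mul (k : ℝ → ℝ → ℝ → ℝ) (μ : Measure ℝ) (s a : ℝ) (φ : ℝ → ℝ) :
    coag k μ s (fun x => a * φ x) = a * coag k μ s φ := by
  simp only [coag, ← integral_const_mul]
  congr 1
  ext Y
  congr 1
  ext Z
  ring

theorem coag_add_nonneg (hk : GoodRate k w M c) {μ : Measure ℝ} [IsFiniteMeasureOnCompacts μ]
    (hw : Integrable w μ) {s : ℝ} (hs : 0 ≤ s) {φ : ℝ → ℝ} (hφ : IsTest φ) (h0 : ∀ x, 0 ≤ φ x)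
    {B : ℝ} (hB : ∫ X, w X ∂μ ≤ B) : 0 ≤ coag k μ s φ + M * B * ∫ X, φ X ∂μ := by
  have h1 : 0 ≤ ∫ X, φ X ∂(gain k μ s) := integral_nonneg h0
  have h2 : ∫ X, φ X * loss k μ s X ∂μ ≤ ∫ X, M * B * φ X ∂μ := by
    refine integral_mono ((hk.isTest_mul_loss μ s hφ).integrable μ)
      ((hφ.integrable μ).const_mul _) fun X => ?_
    show φ X * loss k μ s X ≤ M * B * φ X
    rw [mul_comm]
    have := mul_le_mul_of_nonneg_left hB hk.M_nonneg
    exact mul_le_mul_of_nonneg_right ((hk.loss_le hw hs X).trans this) (h0 X)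
  rw [integral_const_mul] at h2
  rw [hk.coag_eq μ s hφ]
  linarith

theorem continuous_picard_integrand (hk : GoodRate k w M c) {H : ℝ → Measure ℝ}
    (hH : WeakFamily H) (Λ κ : ℝ) {φ : ℝ → ℝ} (hφ : IsTest φ) :
    Continuous fun q : ℝ × ℝ =>
      exp ((κ - Λ) * (q.1 - q.2)) * (coag k (H q.2) q.2 φ + Λ * ∫ X, φ X ∂(H q.2)) := by
  have h1 : Continuous fun q : ℝ × ℝ => coag k (H q.2) q.2 φ :=
    (hk.continuous_coag hH hφ).comp continuous_snd
  have h2 : Continuous fun q : ℝ × ℝ => ∫ X, φ X ∂(H q.2) := (hH.cont φ hφ).comp continuous_snd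
  exact (by fun_prop : Continuous fun q : ℝ × ℝ => exp ((κ - Λ) * (q.1 - q.2))).mul
    (h1.fun_add (h2.const_mul Λ))

theorem intervalIntegrable_picard (hk : GoodRate k w M c) {H : ℝ → Measure ℝ}
    (hH : WeakFamily H) (Λ κ t : ℝ) {φ : ℝ → ℝ} (hφ : IsTest φ) (a b : ℝ) :
    IntervalIntegrable (fun s => exp ((κ - Λ) * (t - s)) *
      (coag k (H s) s φ + Λ * ∫ X, φ X ∂(H s))) volume a b :=
  ((hk.continuous_picard_integrand hH Λ κ hφ).comp
    (by fun_prop : Continuous fun s : ℝ => (t, s))).intervalIntegrable a b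

theorem continuous_picard (hk : GoodRate k w M c) (h0 : Measure ℝ) {H : ℝ → Measure ℝ}
    (hH : WeakFamily H) (Λ κ : ℝ) {φ : ℝ → ℝ} (hφ : IsTest φ) :
    Continuous fun t => picard k Λ κ h0 H t φ := by
  refine Continuous.add (by fun_prop) ?_
  exact intervalIntegral.continuous_parametric_intervalIntegral_of_continuous (μ := volume)
    (hk.continuous_picard_integrand hH Λ κ hφ) continuous_id

theorem picard_add (hk : GoodRate k w M c) (h0 : Measure ℝ) [IsFiniteMeasureOnCompacts h0]
    {H : ℝ → Measure ℝ} (hH : WeakFamily H) (Λ κ t : ℝ) {φ ψ : ℝ → ℝ} (hφ : IsTest φ)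
    (hψ : IsTest ψ) : picard k Λ κ h0 H t (fun x => φ x + ψ x)
      = picard k Λ κ h0 H t φ + picard k Λ κ h0 H t ψ := by
  have := hH.fin
  have e : ∀ s, exp ((κ - Λ) * (t - s)) *
      (coag k (H s) s (fun x => φ x + ψ x) + Λ * ∫ X, φ X + ψ X ∂(H s))
      = exp ((κ - Λ) * (t - s)) * (coag k (H s) s φ + Λ * ∫ X, φ X ∂(H s))
        + exp ((κ - Λ) * (t - s)) * (coag k (H s) s ψ + Λ * ∫ X, ψ X ∂(H s)) := fun s => by
    rw [hk.coag_add _ s hφ hψ, integral_add (hφ.integrable _) (hψ.integrable _)]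
    ring
  simp only [picard, e]
  rw [intervalIntegral.integral_add (hk.intervalIntegrable_picard hH Λ κ t hφ _ _)
    (hk.intervalIntegrable_picard hH Λ κ t hψ _ _),
    integral_add (hφ.integrable _) (hψ.integrable _)]
  ring

end GoodRate

theorem picard_const_mul (k : ℝ → ℝ → ℝ → ℝ) (Λ κ : ℝ) (h0 : Measure ℝ) (H : ℝ → Measure ℝ)
    (t a : ℝ) (φ : ℝ → ℝ) :
    picard k Λ κ h0 H t (fun x => a * φ x) = a * picard k Λ κ h0 H t φ := by
  have e : ∀ s, exp ((κ - Λ) * (t - s)) *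
      (coag k (H s) s (fun x => a * φ x) + Λ * ∫ X, a * φ X ∂(H s))
      = a * (exp ((κ - Λ) * (t - s)) * (coag k (H s) s φ + Λ * ∫ X, φ X ∂(H s))) := fun s => by
    rw [GoodRate.coag_const_mul, integral_const_mul]
    ring
  simp only [picard, e]
  rw [intervalIntegral.integral_const_mul, integral_const_mul]
  ring

/-- Data of the coagulation equation on `[0,T]` with linear growth rate `κ`; the constant `B`
bounds the weighted mass on the whole time interval. -/
structure Datum (k : ℝ → ℝ → ℝ → ℝ) (w : ℝ → ℝ) (M c κ T B : ℝ) (h0 : Measure ℝ) : Prop where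
  rate : GoodRate k w M c
  κ_nonneg : 0 ≤ κ
  T_nonneg : 0 ≤ T
  fin : IsFiniteMeasureOnCompacts h0
  int : Integrable w h0
  bound : exp (κ * T) * ∫ X, w X ∂h0 ≤ B

/-- Weakly continuous families that satisfy the a priori bound of the coagulation equation. -/
structure Admissible (κ T : ℝ) (h0 : Measure ℝ) (H : ℝ → Measure ℝ) : Prop where
  weak : WeakFamily H
  spread : ∀ t ∈ Icc 0 T, Spread (exp (κ * t)) (H t) h0

/-- The Lipschitz constant of the Picard map. -/
def lipConst (κ T M B : ℝ) : ℝ := exp (κ * T) * (4 * M * B + M * B)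

/-- Projection of the real line onto `[0,T]`. -/
def clamp (T t : ℝ) : ℝ := max 0 (min t T)

theorem continuous_clamp (T : ℝ) : Continuous (clamp T) := by
  unfold clamp; fun_prop

theorem clamp_mem {T : ℝ} (hT : 0 ≤ T) (t : ℝ) : clamp T t ∈ Icc 0 T :=
  ⟨le_max_left _ _, max_le hT (min_le_right _ _)⟩

theorem clamp_eq {T t : ℝ} (ht : t ∈ Icc 0 T) : clamp T t = t := by
  rw [clamp, min_eq_left ht.2, max_eq_right ht.1]

namespace Datum

variable {k : ℝ → ℝ → ℝ → ℝ} {w : ℝ → ℝ} {M c κ T B : ℝ} {h0 : Measure ℝ}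

theorem B_nonneg (hd : Datum k w M c κ T B h0) : 0 ≤ B :=
  (mul_nonneg (exp_pos _).le (integral_nonneg fun x => (hd.rate.w_pos x).le)).trans hd.bound

theorem MB_nonneg (hd : Datum k w M c κ T B h0) : 0 ≤ M * B :=
  mul_nonneg hd.rate.M_nonneg hd.B_nonneg

theorem lipConst_nonneg (hd : Datum k w M c κ T B h0) : 0 ≤ lipConst κ T M B := by
  have := hd.MB_nonneg
  unfold lipConst
  have : 0 ≤ 4 * M * B + M * B := by linarith
  positivity

theorem integrable_weight (hd : Datum k w M c κ T B h0) {H : ℝ → Measure ℝ}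
    (hH : Admissible κ T h0 H) {t : ℝ} (ht : t ∈ Icc 0 T) :
    Integrable w (H t) ∧ ∫ X, w X ∂(H t) ≤ B := by
  have := hd.fin
  have := hH.weak.fin
  obtain ⟨h1, h2⟩ := (hH.spread t ht).integrable_weight (exp_pos _).le hd.rate.w_cont
    (fun x => (hd.rate.w_pos x).le) hd.rate.w_anti hd.int
  refine ⟨h1, h2.trans (le_trans ?_ hd.bound)⟩
  refine mul_le_mul_of_nonneg_right (exp_le_exp.2 ?_)
    (integral_nonneg fun x => (hd.rate.w_pos x).le)
  exact mul_le_mul_of_nonneg_left ht.2 hd.κ_nonneg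

theorem picard_nonneg (hd : Datum k w M c κ T B h0) {H : ℝ → Measure ℝ}
    (hH : Admissible κ T h0 H) {t : ℝ} (ht : t ∈ Icc 0 T) {φ : ℝ → ℝ} (hφ : IsTest φ)
    (hφ0 : ∀ x, 0 ≤ φ x) : 0 ≤ picard k (M * B) κ h0 H t φ := by
  have := hH.weak.fin
  refine add_nonneg (mul_nonneg (exp_pos _).le (integral_nonneg hφ0)) ?_
  refine intervalIntegral.integral_nonneg ht.1 fun s hs => mul_nonneg (exp_pos _).le ?_
  obtain ⟨h1, h2⟩ := hd.integrable_weight hH ⟨hs.1, hs.2.trans ht.2⟩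
  exact hd.rate.coag_add_nonneg h1 hs.1 hφ hφ0 h2

theorem exp_identity (a b t : ℝ) (I : ℝ) :
    exp ((a - b) * t) * I + ∫ s in (0:ℝ)..t, exp ((a - b) * (t - s)) * (b * (exp (a * s) * I))
      = exp (a * t) * I := by
  have hd : ∀ s, HasDerivAt (fun s => exp ((a - b) * (t - s)) * (exp (a * s) * I))
      (exp ((a - b) * (t - s)) * (b * (exp (a * s) * I))) s := by
    intro s
    have h1 : HasDerivAt (fun s => exp ((a - b) * (t - s)))
        (exp ((a - b) * (t - s)) * ((a - b) * (0 - 1))) s :=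
      (((hasDerivAt_const s t).sub (hasDerivAt_id s)).const_mul (a - b)).exp
    have h2 : HasDerivAt (fun s => exp (a * s) * I) (exp (a * s) * (a * 1) * I) s :=
      (((hasDerivAt_id s).const_mul a).exp).mul_const I
    exact (h1.mul h2).congr_deriv (by ring)
  rw [intervalIntegral.integral_eq_sub_of_hasDerivAt (fun s _ => hd s)
    (Continuous.intervalIntegrable (by fun_prop) _ _)]
  simp

theorem picard_le (hd : Datum k w M c κ T B h0) {H : ℝ → Measure ℝ}
    (hH : Admissible κ T h0 H) {t : ℝ} (ht : t ∈ Icc 0 T) {φ : ℝ → ℝ} (hφ : IsTest φ)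
    (hφ0 : ∀ x, 0 ≤ φ x) (hφa : AntitoneOn φ (Ici 0)) :
    picard k (M * B) κ h0 H t φ ≤ exp (κ * t) * ∫ X, φ X ∂h0 := by
  rw [← exp_identity κ (M * B) t, picard]
  refine add_le_add le_rfl ?_
  refine intervalIntegral.integral_mono_on ht.1
    (hd.rate.intervalIntegrable_picard hH.weak _ _ _ hφ _ _) ?_ fun s hs => ?_
  · exact Continuous.intervalIntegrable (by fun_prop) _ _
  refine mul_le_mul_of_nonneg_left ?_ (exp_pos _).le
  have h1 := hd.rate.coag_nonpos (H s) s hφa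
  have h2 := mul_le_mul_of_nonneg_left
    (hH.spread s ⟨hs.1, hs.2.trans ht.2⟩ φ hφ hφ0 hφa) hd.MB_nonneg
  linarith

/-- One Picard step. -/
theorem exists_step (hd : Datum k w M c κ T B h0) {H : ℝ → Measure ℝ}
    (hH : Admissible κ T h0 H) :
    ∃ H', Admissible κ T h0 H' ∧ ∀ t ∈ Icc 0 T, ∀ φ, IsTest φ →
      ∫ X, φ X ∂(H' t) = picard k (M * B) κ h0 H t φ := by
  have := hd.fin
  have hex : ∀ t, ∃ μ : Measure ℝ, IsFiniteMeasureOnCompacts μ ∧ ∀ φ, IsTest φ →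
      ∫ X, φ X ∂μ = picard k (M * B) κ h0 H (clamp T t) φ := fun t =>
    exists_measure_of_functional _
      (fun φ ψ hφ hψ => hd.rate.picard_add h0 hH.weak _ _ _ hφ hψ)
      (fun a φ _ => picard_const_mul _ _ _ _ _ _ _ _)
      (fun φ hφ hφ0 => hd.picard_nonneg hH (clamp_mem hd.T_nonneg t) hφ hφ0)
  choose H' hfin hint using hex
  have hval : ∀ t ∈ Icc 0 T, ∀ φ, IsTest φ →
      ∫ X, φ X ∂(H' t) = picard k (M * B) κ h0 H t φ := fun t ht φ hφ => by
    rw [hint t φ hφ, clamp_eq ht]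
  refine ⟨H', ⟨⟨hfin, fun φ hφ => ?_⟩, fun t ht φ hφ hφ0 hφa => ?_⟩, hval⟩
  · simp only [hint _ φ hφ]
    exact (hd.rate.continuous_picard h0 hH.weak _ _ hφ).comp (continuous_clamp T)
  · rw [hval t ht φ hφ]
    exact hd.picard_le hH ht hφ hφ0 hφa

/-- The Picard map is a Volterra contraction. -/
theorem abs_picard_sub_le (hd : Datum k w M c κ T B h0) {G H : ℝ → Measure ℝ}
    (hG : Admissible κ T h0 G) (hH : Admissible κ T h0 H) {g : ℝ → ℝ} (hg : Continuous g)
    {t : ℝ} (ht : t ∈ Icc 0 T) (hc : ∀ s ∈ Icc 0 t, Close w (g s) (G s) (H s)) {φ : ℝ → ℝ}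
    (hφ : IsTest φ) {K : ℝ} (hK : 0 ≤ K) (hφK : ∀ x, |φ x| ≤ K * w x) :
    |picard k (M * B) κ h0 G t φ - picard k (M * B) κ h0 H t φ|
      ≤ K * (lipConst κ T M B * ∫ s in (0:ℝ)..t, g s) := by
  have hfG := hG.weak.fin
  have hfH := hH.weak.fin
  have iG := hd.rate.intervalIntegrable_picard hG.weak (M * B) κ t hφ 0 t
  have iH := hd.rate.intervalIntegrable_picard hH.weak (M * B) κ t hφ 0 t
  rw [picard, picard, add_sub_add_left_eq_sub, ← intervalIntegral.integral_sub iG iH,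
    ← intervalIntegral.integral_const_mul, ← intervalIntegral.integral_const_mul]
  refine (intervalIntegral.abs_integral_le_integral_abs ht.1).trans
    (intervalIntegral.integral_mono_on ht.1 (iG.sub iH).abs
      (Continuous.intervalIntegrable (by fun_prop) _ _) fun s hs => ?_)
  have hsT : s ∈ Icc 0 T := ⟨hs.1, hs.2.trans ht.2⟩
  obtain ⟨wG, bG⟩ := hd.integrable_weight hG hsT
  obtain ⟨wH, bH⟩ := hd.integrable_weight hH hsT
  have h1 := hd.rate.abs_coag_sub_le wG wH bG bH (hc s hs) hs.1 hφ hK hφK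
  have h2 := hc s hs K hK φ hφ hφK
  have hMB := hd.MB_nonneg
  have hexp : exp ((κ - M * B) * (t - s)) ≤ exp (κ * T) := by
    refine exp_le_exp.2 (le_trans (mul_le_mul_of_nonneg_right
      (sub_le_self _ hMB) (sub_nonneg.2 hs.2)) ?_)
    exact mul_le_mul_of_nonneg_left (by linarith [hs.1, ht.2]) hd.κ_nonneg
  rw [← mul_sub, abs_mul, abs_of_pos (exp_pos _)]
  have h3 : |coag k (G s) s φ + M * B * ∫ X, φ X ∂(G s)
      - (coag k (H s) s φ + M * B * ∫ X, φ X ∂(H s))| ≤ K * ((4 * M * B + M * B) * g s) := by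
    have e : coag k (G s) s φ + M * B * ∫ X, φ X ∂(G s)
        - (coag k (H s) s φ + M * B * ∫ X, φ X ∂(H s))
        = (coag k (G s) s φ - coag k (H s) s φ)
          + M * B * ((∫ X, φ X ∂(G s)) - ∫ X, φ X ∂(H s)) := by ring
    rw [e]
    refine (abs_add_le _ _).trans ?_
    rw [abs_mul, abs_of_nonneg hMB]
    have := mul_le_mul_of_nonneg_left h2 hMB
    linarith
  calc _ ≤ exp (κ * T) * (K * ((4 * M * B + M * B) * g s)) :=
        mul_le_mul hexp h3 (abs_nonneg _) (exp_pos _).le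
    _ = _ := by rw [lipConst]; ring

theorem close_picard (hd : Datum k w M c κ T B h0) {G H : ℝ → Measure ℝ}
    (hG : Admissible κ T h0 G) (hH : Admissible κ T h0 H) {D : ℝ} {n : ℕ}
    (hc : ∀ s ∈ Icc 0 T, Close w (D * ((lipConst κ T M B * s) ^ n / n.factorial)) (G s) (H s))
    {t : ℝ} (ht : t ∈ Icc 0 T) {φ : ℝ → ℝ} (hφ : IsTest φ) {K : ℝ} (hK : 0 ≤ K)
    (hφK : ∀ x, |φ x| ≤ K * w x) :
    |picard k (M * B) κ h0 G t φ - picard k (M * B) κ h0 H t φ|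
      ≤ K * (D * ((lipConst κ T M B * t) ^ (n + 1) / (n + 1).factorial)) := by
  have h := hd.abs_picard_sub_le hG hH
    (g := fun s => D * ((lipConst κ T M B * s) ^ n / n.factorial)) (by fun_prop) ht
    (fun s hs => hc s ⟨hs.1, hs.2.trans ht.2⟩) hφ hK hφK
  have e : lipConst κ T M B * ∫ s in (0:ℝ)..t, D * ((lipConst κ T M B * s) ^ n / n.factorial)
      = D * ((lipConst κ T M B * t) ^ (n + 1) / (n + 1).factorial) := by
    simp only [mul_pow]
    rw [intervalIntegral.integral_const_mul, intervalIntegral.integral_div,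
      intervalIntegral.integral_const_mul, integral_pow, Nat.factorial_succ]
    push_cast
    have : (n.factorial : ℝ) ≠ 0 := by positivity
    have : (n : ℝ) + 1 ≠ 0 := by positivity
    field_simp
    ring
  rwa [e] at h

theorem close_of_admissible (hd : Datum k w M c κ T B h0) {G H : ℝ → Measure ℝ}
    (hG : Admissible κ T h0 G) (hH : Admissible κ T h0 H) {t : ℝ} (ht : t ∈ Icc 0 T) :
    Close w (2 * B) (G t) (H t) := by
  intro K hK φ _ hφK
  have key : ∀ {F : ℝ → Measure ℝ}, Admissible κ T h0 F → |∫ X, φ X ∂(F t)| ≤ K * B := by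
    intro F hF
    obtain ⟨h1, h2⟩ := hd.integrable_weight hF ht
    have : ‖∫ X, φ X ∂(F t)‖ ≤ ∫ X, K * w X ∂(F t) :=
      norm_integral_le_of_norm_le (h1.const_mul K) (Eventually.of_forall hφK)
    rw [integral_const_mul] at this
    exact this.trans (mul_le_mul_of_nonneg_left h2 hK)
  have h1 := key hG
  have h2 := key hH
  have := abs_sub (∫ X, φ X ∂(G t)) (∫ X, φ X ∂(H t))
  linarith

theorem admissible_const (hd : Datum k w M c κ T B h0) : Admissible κ T h0 fun _ => h0 := by
  have := hd.fin
  refine ⟨weakFamily_const h0, fun t ht φ _ hφ0 _ => ?_⟩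
  exact le_mul_of_one_le_left (integral_nonneg hφ0)
    (one_le_exp (mul_nonneg hd.κ_nonneg ht.1))

/-- Admissible fixed points of the Picard map are unique. -/
theorem eq_of_fixed (hd : Datum k w M c κ T B h0) {G H : ℝ → Measure ℝ}
    (hG : Admissible κ T h0 G) (hH : Admissible κ T h0 H)
    (fG : ∀ t ∈ Icc 0 T, ∀ φ, IsTest φ → ∫ X, φ X ∂(G t) = picard k (M * B) κ h0 G t φ)
    (fH : ∀ t ∈ Icc 0 T, ∀ φ, IsTest φ → ∫ X, φ X ∂(H t) = picard k (M * B) κ h0 H t φ)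
    {t : ℝ} (ht : t ∈ Icc 0 T) : G t = H t := by
  have hfG := hG.weak.fin
  have hfH := hH.weak.fin
  have key : ∀ n : ℕ, ∀ s ∈ Icc 0 T,
      Close w (2 * B * ((lipConst κ T M B * s) ^ n / n.factorial)) (G s) (H s) := by
    intro n
    induction n with
    | zero =>
      intro s hs
      simpa using hd.close_of_admissible hG hH hs
    | succ n ih =>
      intro s hs K hK φ hφ hφK
      rw [fG s hs φ hφ, fH s hs φ hφ]
      exact hd.close_picard hG hH ih hs hφ hK hφK
  refine measure_eq_of_integral_eq fun φ hφ => ?_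
  obtain ⟨K, hK, hφK⟩ := hφ.exists_le_weight hd.rate.w_cont hd.rate.w_pos
  have hlim : Tendsto (fun n : ℕ =>
      K * (2 * B * ((lipConst κ T M B * t) ^ n / n.factorial))) atTop (𝓝 0) := by
    have := FloorSemiring.tendsto_pow_div_factorial_atTop (lipConst κ T M B * t)
    simpa using (this.const_mul (2 * B)).const_mul K
  have := ge_of_tendsto' hlim fun n => key n t ht K hK φ hφ hφK
  exact sub_eq_zero.1 (abs_nonpos_iff.1 this)

/-- The Picard map has an admissible fixed point. -/
theorem exists_fixed (hd : Datum k w M c κ T B h0) :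
    ∃ H, Admissible κ T h0 H ∧ ∀ t ∈ Icc 0 T, ∀ φ, IsTest φ →
      ∫ X, φ X ∂(H t) = picard k (M * B) κ h0 H t φ := by
  have hf0 := hd.fin
  choose step hstep hval using
    fun H : {H // Admissible κ T h0 H} => hd.exists_step H.2
  let S : ℕ → {H // Admissible κ T h0 H} := fun n =>
    Nat.rec ⟨_, hd.admissible_const⟩ (fun _ H => ⟨step H, hstep H⟩) n
  have hS : ∀ n, ∀ t ∈ Icc 0 T, ∀ φ, IsTest φ →
      ∫ X, φ X ∂((S (n + 1)).1 t) = picard k (M * B) κ h0 (S n).1 t φ := fun n => hval (S n)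
  have hSfin : ∀ n t, IsFiniteMeasureOnCompacts ((S n).1 t) := fun n => (S n).2.weak.fin
  set C := lipConst κ T M B with hC
  have hC0 : 0 ≤ C := hd.lipConst_nonneg
  have hB0 := hd.B_nonneg
  have hclose : ∀ n : ℕ, ∀ t ∈ Icc 0 T,
      Close w (2 * B * ((C * t) ^ n / n.factorial)) ((S n).1 t) ((S (n + 1)).1 t) := by
    intro n
    induction n with
    | zero =>
      intro s hs
      simpa using hd.close_of_admissible (S 0).2 (S 1).2 hs
    | succ n ih =>
      intro s hs K hK φ hφ hφK
      rw [hS n s hs φ hφ, hS (n + 1) s hs φ hφ]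
      exact hd.close_picard (S n).2 (S (n + 1)).2 ih hs hφ hK hφK
  set d : ℕ → ℝ := fun n => 2 * B * ((C * T) ^ n / n.factorial) with hdd
  have hdsum : Summable d := (summable_pow_div_factorial (C * T)).mul_left _
  have hstep' : ∀ n : ℕ, ∀ t ∈ Icc 0 T, ∀ φ, IsTest φ → ∀ K, 0 ≤ K → (∀ x, |φ x| ≤ K * w x) →
      dist (∫ X, φ X ∂((S n).1 t)) (∫ X, φ X ∂((S (n + 1)).1 t)) ≤ K * d n := by
    intro n t ht φ hφ K hK hφK
    refine (hclose n t ht K hK φ hφ hφK).trans ?_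
    have := mul_nonneg hC0 ht.1
    have := ht.2
    simp only [hdd]
    gcongr
  have hlim : ∀ t ∈ Icc 0 T, ∀ φ, IsTest φ →
      ∃ L, Tendsto (fun n => ∫ X, φ X ∂((S n).1 t)) atTop (𝓝 L) := by
    intro t ht φ hφ
    obtain ⟨K, hK, hφK⟩ := hφ.exists_le_weight hd.rate.w_cont hd.rate.w_pos
    exact cauchySeq_tendsto_of_complete (cauchySeq_of_dist_le_of_summable _
      (fun n => hstep' n t ht φ hφ K hK hφK) (hdsum.mul_left K))
  have hex : ∀ t, ∃ μ : Measure ℝ, IsFiniteMeasureOnCompacts μ ∧ ∀ φ, IsTest φ →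
      Tendsto (fun n => ∫ X, φ X ∂((S n).1 (clamp T t))) atTop (𝓝 (∫ X, φ X ∂μ)) := by
    intro t
    have htT := clamp_mem hd.T_nonneg t
    have hl : ∀ φ, IsTest φ → Tendsto (fun n => ∫ X, φ X ∂((S n).1 (clamp T t))) atTop
        (𝓝 (limUnder atTop fun n => ∫ X, φ X ∂((S n).1 (clamp T t)))) := fun φ hφ =>
      tendsto_nhds_limUnder (hlim _ htT φ hφ)
    obtain ⟨μ, hμ, hint⟩ := exists_measure_of_functional
      (fun φ => limUnder atTop fun n => ∫ X, φ X ∂((S n).1 (clamp T t)))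
      (fun φ ψ hφ hψ => by
        refine Tendsto.limUnder_eq (((hl φ hφ).add (hl ψ hψ)).congr fun n => ?_)
        rw [integral_add (hφ.integrable _) (hψ.integrable _)])
      (fun a φ hφ => by
        refine Tendsto.limUnder_eq (((hl φ hφ).const_mul a).congr fun n => ?_)
        rw [integral_const_mul])
      (fun φ hφ hφ0 => ge_of_tendsto' (hl φ hφ) fun n => integral_nonneg hφ0)
    exact ⟨μ, hμ, fun φ hφ => hint φ hφ ▸ hl φ hφ⟩
  choose H hHfin hHlim using hex
  set ε : ℕ → ℝ := fun n => ∑' m, d (n + m) with hε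
  have hε0 : Tendsto ε atTop (𝓝 0) := by
    have := tendsto_sum_nat_add d
    simpa only [hε, add_comm] using this
  have hHclose : ∀ n t φ, IsTest φ → ∀ K, 0 ≤ K → (∀ x, |φ x| ≤ K * w x) →
      |(∫ X, φ X ∂((S n).1 (clamp T t))) - ∫ X, φ X ∂(H t)| ≤ K * ε n := by
    intro n t φ hφ K hK hφK
    have := dist_le_tsum_of_dist_le_of_tendsto _
      (fun n => hstep' n _ (clamp_mem hd.T_nonneg t) φ hφ K hK hφK) (hdsum.mul_left K)
      (hHlim t φ hφ) n
    rwa [tsum_mul_left, dist_eq] at this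
  have hHc : ∀ t ∈ Icc 0 T, ∀ φ, IsTest φ →
      Tendsto (fun n => ∫ X, φ X ∂((S n).1 t)) atTop (𝓝 (∫ X, φ X ∂(H t))) := by
    intro t ht φ hφ
    have := hHlim t φ hφ
    rwa [clamp_eq ht] at this
  have hHadm : Admissible κ T h0 H := by
    refine ⟨⟨hHfin, fun φ hφ => ?_⟩, fun t ht φ hφ hφ0 hφa => ?_⟩
    · obtain ⟨K, hK, hφK⟩ := hφ.exists_le_weight hd.rate.w_cont hd.rate.w_pos
      have hu : TendstoUniformly (fun n t => ∫ X, φ X ∂((S n).1 (clamp T t)))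
          (fun t => ∫ X, φ X ∂(H t)) atTop := by
        rw [Metric.tendstoUniformly_iff]
        intro η hη
        have h1 : Tendsto (fun n => K * ε n) atTop (𝓝 0) := by simpa using hε0.const_mul K
        filter_upwards [h1.eventually (gt_mem_nhds hη)] with n hn t
        rw [dist_comm, dist_eq]
        exact (hHclose n t φ hφ K hK hφK).trans_lt hn
      exact hu.continuous (Eventually.of_forall fun n =>
        ((S n).2.weak.cont φ hφ).comp (continuous_clamp T)).frequently
    · exact le_of_tendsto' (hHc t ht φ hφ) fun n => (S n).2.spread t ht φ hφ hφ0 hφa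
  refine ⟨H, hHadm, fun t ht φ hφ => ?_⟩
  obtain ⟨K, hK, hφK⟩ := hφ.exists_le_weight hd.rate.w_cont hd.rate.w_pos
  have hp : Tendsto (fun n => picard k (M * B) κ h0 (S n).1 t φ) atTop
      (𝓝 (picard k (M * B) κ h0 H t φ)) := by
    rw [tendsto_iff_dist_tendsto_zero]
    have h1 : Tendsto (fun n => K * (C * ∫ _ in (0:ℝ)..t, ε n)) atTop (𝓝 0) := by
      simp only [intervalIntegral.integral_const, smul_eq_mul]
      simpa using ((hε0.const_mul (t - 0)).const_mul C).const_mul K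
    refine squeeze_zero (fun _ => dist_nonneg) (fun n => ?_) h1
    rw [dist_eq]
    refine hd.abs_picard_sub_le (S n).2 hHadm continuous_const ht (fun s hs => ?_) hφ hK hφK
    intro K' hK' ψ hψ hψK
    have := hHclose n s ψ hψ K' hK' hψK
    rwa [clamp_eq ⟨hs.1, hs.2.trans ht.2⟩] at this
  refine tendsto_nhds_unique ((hHc t ht φ hφ).comp (tendsto_add_atTop_nat 1))
    (hp.congr fun n => ?_)
  exact (hS n t ht φ hφ).symm

end Datum

namespace GoodRate

variable {k : ℝ → ℝ → ℝ → ℝ} {w : ℝ → ℝ} {M c : ℝ}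

theorem duhamel_const_iff (hk : GoodRate k w M c) {h0 : Measure ℝ} {H : ℝ → Measure ℝ}
    (hH : WeakFamily H) (Λ κ T : ℝ) :
    Duhamel (fun _ _ => Λ - κ) (fun X s => Λ - loss k (H s) s X) h0
        (fun s => gain k (H s) s) H T ↔
      ∀ t ∈ Icc 0 T, ∀ φ, IsTest φ → ∫ X, φ X ∂(H t) = picard k Λ κ h0 H t φ := by
  have hfin := hH.fin
  have e : ∀ s t x, damp (fun _ _ => Λ - κ) s t x = exp ((κ - Λ) * (t - s)) := by
    intro s t x
    rw [damp, intervalIntegral.integral_const, smul_eq_mul]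
    congr 1
    ring
  have : ∀ t φ, IsTest φ → (∫ X, φ X * damp (fun _ _ => Λ - κ) 0 t X ∂h0)
      + ∫ s in (0:ℝ)..t, ((∫ X, φ X * damp (fun _ _ => Λ - κ) s t X ∂(gain k (H s) s))
          + ∫ X, φ X * damp (fun _ _ => Λ - κ) s t X * (Λ - loss k (H s) s X) ∂(H s))
      = picard k Λ κ h0 H t φ := by
    intro t φ hφ
    simp only [e, integral_mul_const, sub_zero, picard]
    rw [mul_comm]
    congr 2
    ext s
    have h1 : ∫ X, φ X * exp ((κ - Λ) * (t - s)) * (Λ - loss k (H s) s X) ∂(H s)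
        = exp ((κ - Λ) * (t - s)) *
          (Λ * (∫ X, φ X ∂(H s)) - ∫ X, φ X * loss k (H s) s X ∂(H s)) := by
      rw [← integral_const_mul, ← integral_sub ((hφ.integrable _).const_mul _)
        ((hk.isTest_mul_loss _ s hφ).integrable _), ← integral_const_mul]
      congr 1
      ext X
      ring
    rw [h1, hk.coag_eq _ s hφ]
    ring
  exact forall₂_congr fun t _ => forall₂_congr fun φ hφ => by rw [this t φ hφ]

/-- Duhamel's formula with the physical removal rate is a fixed point equation for the Picard
map, for every choice of the artificial removal rate. -/
theorem duhamel_iff (hk : GoodRate k w M c) {h0 : Measure ℝ} [IsFiniteMeasureOnCompacts h0]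
    {H : ℝ → Measure ℝ} (hH : WeakFamily H) (Λ κ T : ℝ) :
    Duhamel (fun X s => loss k (H s) s X - κ) (fun _ _ => 0) h0
        (fun s => gain k (H s) s) H T ↔
      ∀ t ∈ Icc 0 T, ∀ φ, IsTest φ → ∫ X, φ X ∂(H t) = picard k Λ κ h0 H t φ := by
  rw [← hk.duhamel_const_iff hH]
  have hQ := hk.weakFamily_gain hH
  have hl := hk.continuous_loss hH
  have hA : Continuous (Function.uncurry fun X s => loss k (H s) s X - κ) :=
    hl.sub continuous_const
  have hA' : Continuous (Function.uncurry fun _ _ : ℝ => Λ - κ) := continuous_const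
  have hb' : Continuous (Function.uncurry fun X s => Λ - loss k (H s) s X) :=
    continuous_const.sub hl
  constructor
  · intro h
    have := h.change_rate hH hQ hA hA' (continuous_const (y := (0:ℝ)))
    convert this using 3
    ring
  · intro h
    have := h.change_rate hH hQ hA' hA hb'
    convert this using 3
    ring

/-- The a priori bound. -/
theorem admissible_of_duhamel (hk : GoodRate k w M c) {h0 : Measure ℝ}
    [IsFiniteMeasureOnCompacts h0] {H : ℝ → Measure ℝ} (hH : WeakFamily H) {κ T : ℝ}
    (h : Duhamel (fun X s => loss k (H s) s X - κ) (fun _ _ => 0) h0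
      (fun s => gain k (H s) s) H T) : Admissible κ T h0 H := by
  refine ⟨hH, fun t ht φ hφ _ hφa => ?_⟩
  rw [(hk.duhamel_iff hH 0 κ T).1 h t ht φ hφ, picard, sub_zero]
  rw [intervalIntegral.integral_of_le ht.1]
  refine add_le_of_nonpos_right (setIntegral_nonpos measurableSet_Ioc fun s _ => ?_)
  rw [zero_mul, add_zero]
  exact mul_nonpos_of_nonneg_of_nonpos (exp_pos _).le (hk.coag_nonpos _ s hφa)

end GoodRate

/-- The collision rate, divided by the size of the partner, in self-similar variables. -/
def rescaledRate (Kl : ℝ → ℝ → ℝ) (β s Y Z : ℝ) : ℝ :=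
  Kl (Y * exp (-(β * s))) (Z * exp (-(β * s))) / Z

namespace IsMildSolution

variable {Kl : ℝ → ℝ → ℝ} {β ρ T : ℝ} {h0 : Measure ℝ} {G H : ℝ → Measure ℝ}

theorem mono {T' : ℝ} (h : IsMildSolution Kl β ρ T h0 H) (hT : T' ≤ T) :
    IsMildSolution Kl β ρ T' h0 H := by
  have hsub : Icc 0 T' ⊆ Icc 0 T := Icc_subset_Icc_right hT
  exact ⟨fun t ht => h.1 t (hsub ht), fun φ hc hs => (h.2.1 φ hc hs).mono hsub,
    fun t ht => h.2.2 t (hsub ht)⟩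

theorem congr (h : IsMildSolution Kl β ρ T h0 H) (hG : ∀ t ∈ Icc 0 T, G t = H t) :
    IsMildSolution Kl β ρ T h0 G := by
  refine ⟨fun t ht => hG t ht ▸ h.1 t ht, fun φ hc hs => ?_, fun t ht φ hc hs => ?_⟩
  · exact (h.2.1 φ hc hs).congr fun t ht => by rw [hG t ht]
  · have hA : ∀ s ∈ Icc 0 t, ∀ X, ∫ ξ in s..t, Acal Kl β ρ G X ξ
        = ∫ ξ in s..t, Acal Kl β ρ H X ξ := by
      intro s hs X
      refine intervalIntegral.integral_congr fun ξ hξ => ?_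
      rw [uIcc_of_le hs.2] at hξ
      simp only [Acal, hG ξ ⟨hs.1.trans hξ.1, hξ.2.trans ht.2⟩]
    rw [hG t ht, h.2.2 t ht φ hc hs]
    congr 1
    · simp only [hA 0 ⟨le_rfl, ht.1⟩]
    · refine intervalIntegral.integral_congr fun s hs => ?_
      rw [uIcc_of_le ht.1] at hs
      simp only [hA s hs, Qcal, hG s ⟨hs.1, hs.2.trans ht.2⟩]

theorem duhamel (h : IsMildSolution Kl β ρ T h0 H) :
    Duhamel (fun X s => loss (rescaledRate Kl β) (H s) s X - β * ρ) (fun _ _ => 0) h0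
      (fun s => gain (rescaledRate Kl β) (H s) s) H T := by
  intro t ht φ hφ
  simp only [mul_zero, integral_zero, add_zero]
  exact h.2.2 t ht φ (isTest_iff.1 hφ).1 (isTest_iff.1 hφ).2

end IsMildSolution

section Solution

variable {Kl : ℝ → ℝ → ℝ} {β ρ T : ℝ} {h0 : Measure ℝ} {w : ℝ → ℝ} {M c B : ℝ}

/-- Existence on a bounded time interval, together with the a priori bound. -/
theorem exists_isMildSolution
    (hd : Datum (rescaledRate Kl β) w M c (β * ρ) T B h0) (hh0 : MemX ρ h0) :
    ∃ H, Admissible (β * ρ) T h0 H ∧ IsMildSolution Kl β ρ T h0 H := by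
  have := hd.fin
  obtain ⟨H, hH, hfix⟩ := hd.exists_fixed
  have hfin := hH.weak.fin
  have hD := (hd.rate.duhamel_iff hH.weak (M * B) (β * ρ) T).2 hfix
  refine ⟨H, hH, fun t ht => hh0.of_spread (exp_pos _).le (hH.spread t ht),
    fun φ hc hs => (hH.weak.cont φ (isTest_iff.2 ⟨hc, hs⟩)).continuousOn, fun t ht φ hc hs => ?_⟩
  have := hD t ht φ (isTest_iff.2 ⟨hc, hs⟩)
  simp only [mul_zero, integral_zero, add_zero] at this
  exact this

/-- Uniqueness on a bounded time interval. -/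
theorem IsMildSolution.unique (hd : Datum (rescaledRate Kl β) w M c (β * ρ) T B h0)
    {G H : ℝ → Measure ℝ} (hG : IsMildSolution Kl β ρ T h0 G)
    (hH : IsMildSolution Kl β ρ T h0 H) {t : ℝ} (ht : t ∈ Icc 0 T) : G t = H t := by
  have := hd.fin
  have key : ∀ {F : ℝ → Measure ℝ}, IsMildSolution Kl β ρ T h0 F →
      Admissible (β * ρ) T h0 (fun s => F (clamp T s)) ∧ ∀ s ∈ Icc 0 T, ∀ φ, IsTest φ →
        ∫ X, φ X ∂(F (clamp T s))
          = picard (rescaledRate Kl β) (M * B) (β * ρ) h0 (fun s => F (clamp T s)) s φ := by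
    intro F hF
    have hF' := hF.congr (G := fun s => F (clamp T s)) fun s hs => by rw [clamp_eq hs]
    have hw : WeakFamily fun s => F (clamp T s) := by
      refine ⟨fun s => (hF.1 _ (clamp_mem hd.T_nonneg s)).isFiniteMeasureOnCompacts,
        fun φ hφ => ?_⟩
      obtain ⟨hc, hs⟩ := isTest_iff.1 hφ
      exact (hF.2.1 φ hc hs).comp_continuous (continuous_clamp T) (clamp_mem hd.T_nonneg)
    exact ⟨hd.rate.admissible_of_duhamel hw hF'.duhamel,
      (hd.rate.duhamel_iff hw _ _ _).1 hF'.duhamel⟩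
  have := hd.eq_of_fixed (key hG).1 (key hH).1 (key hG).2 (key hH).2 ht
  simpa only [clamp_eq ht] using this

end Solution

namespace CutoffHyp

variable {ζ : ℝ → ℝ}

theorem nonneg (hζ : CutoffHyp ζ) (s : ℝ) : 0 ≤ ζ s := by
  rcases le_total s 0 with hs | hs
  · rw [hζ.zero s (by linarith)]
  · rw [← hζ.zero 0 (by norm_num)]
    exact hζ.mono self_mem_Ici hs hs

theorem le_one (hζ : CutoffHyp ζ) (s : ℝ) : ζ s ≤ 1 := by
  rcases le_total s 0 with hs | hs
  · rw [hζ.zero s (by linarith)]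
    exact zero_le_one
  · rw [← hζ.one (max s 1) (le_max_right _ _)]
    exact hζ.mono hs (hs.trans (le_max_left _ _)) (le_max_left _ _)

theorem continuous (hζ : CutoffHyp ζ) : Continuous ζ := by
  refine continuous_iff_continuousAt.2 fun s => ?_
  rcases lt_or_ge s (1/2) with hs | hs
  · refine (continuousAt_const (y := (0:ℝ))).congr ?_
    filter_upwards [gt_mem_nhds hs] with x hx
    exact (hζ.zero x hx.le).symm
  · exact hζ.smooth.continuousOn.continuousAt (Ici_mem_nhds (by linarith))

theorem lt_of_ne_zero (hζ : CutoffHyp ζ) {s : ℝ} (h : ζ s ≠ 0) : 1/2 < s := by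
  by_contra! hs
  exact h (hζ.zero s hs)

end CutoffHyp

section Kernel

variable {K : ℝ → ℝ → ℝ} {ζ : ℝ → ℝ} {γ C lam : ℝ}

theorem Kreg_supp (hζ : CutoffHyp ζ) (hlam : 0 < lam) {y z : ℝ} (h : Kreg K ζ lam y z ≠ 0) :
    lam / 2 < y ∧ lam / 2 < z ∧ z ≤ 2 / lam * y ∧ y ≤ 2 / lam * z := by
  simp only [Kreg, ne_eq, mul_eq_zero, not_or] at h
  obtain ⟨⟨⟨⟨-, h1⟩, h2⟩, h3⟩, h4⟩ := h
  have h1 := hζ.lt_of_ne_zero h1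
  have h2 := hζ.lt_of_ne_zero h2
  have h3 := hζ.lt_of_ne_zero h3
  have h4 := hζ.lt_of_ne_zero h4
  rw [lt_div_iff₀ hlam] at h1 h2
  have hy : 0 < y := by linarith [hlam]
  have hz : 0 < z := by linarith [hlam]
  rw [lt_div_iff₀ (by positivity)] at h3 h4
  refine ⟨by linarith, by linarith, ?_, ?_⟩
  · rw [div_mul_eq_mul_div, le_div_iff₀ hlam]
    nlinarith
  · rw [div_mul_eq_mul_div, le_div_iff₀ hlam]
    nlinarith

theorem Kreg_nonneg (hK : KernelHyp K γ C) (hζ : CutoffHyp ζ) (hlam : 0 < lam) (y z : ℝ) :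
    0 ≤ Kreg K ζ lam y z := by
  by_cases h : Kreg K ζ lam y z = 0
  · exact h.ge
  · obtain ⟨hy, hz, -, -⟩ := Kreg_supp hζ hlam h
    have := hK.nonneg y z (by linarith) (by linarith)
    have := hζ.nonneg
    unfold Kreg
    have := this (y / lam)
    have := hζ.nonneg (z / lam)
    have := hζ.nonneg (y / (lam * (y + z)))
    have := hζ.nonneg (z / (lam * (y + z)))
    positivity

theorem Kreg_le (hK : KernelHyp K γ C) (hζ : CutoffHyp ζ) {y z : ℝ} (hy : 0 < y) (hz : 0 < z) :
    Kreg K ζ lam y z ≤ K y z := by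
  have h0 := hK.nonneg y z hy hz
  have step : ∀ {a : ℝ}, 0 ≤ a → ∀ s, a * ζ s ≤ a := fun ha s =>
    mul_le_of_le_one_right ha (hζ.le_one s)
  have n1 := mul_nonneg h0 (hζ.nonneg (y / lam))
  have n2 := mul_nonneg n1 (hζ.nonneg (z / lam))
  have n3 := mul_nonneg n2 (hζ.nonneg (y / (lam * (y + z))))
  exact (step n3 _).trans ((step n2 _).trans ((step n1 _).trans (step h0 _)))

theorem continuous_Kreg (hK : KernelHyp K γ C) (hζ : CutoffHyp ζ) (hlam : 0 < lam) :
    Continuous fun p : ℝ × ℝ => Kreg K ζ lam p.1 p.2 := by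
  refine continuous_iff_continuousAt.2 fun p => ?_
  by_cases hp : 0 < p.1 ∧ 0 < p.2
  · obtain ⟨h1, h2⟩ := hp
    have hKc : ContinuousAt (fun p : ℝ × ℝ => K p.1 p.2) p :=
      hK.cont.continuousAt ((isOpen_Ioi.prod isOpen_Ioi).mem_nhds ⟨h1, h2⟩)
    have hc := hζ.continuous
    have hne : lam * (p.1 + p.2) ≠ 0 := by positivity
    have ha : ContinuousAt (fun p : ℝ × ℝ => lam * (p.1 + p.2)) p := by fun_prop
    unfold Kreg
    refine (((hKc.mul ?_).mul ?_).mul ?_).mul ?_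
    · exact (hc.comp (by fun_prop)).continuousAt
    · exact (hc.comp (by fun_prop)).continuousAt
    · exact hc.continuousAt.comp (continuousAt_fst.div ha hne)
    · exact hc.continuousAt.comp (continuousAt_snd.div ha hne)
  · refine (continuousAt_const (y := (0:ℝ))).congr ?_
    have : ∀ᶠ q : ℝ × ℝ in 𝓝 p, q.1 < lam / 2 ∨ q.2 < lam / 2 := by
      rw [not_and_or, not_lt, not_lt] at hp
      rcases hp with h | h
      · exact (continuousAt_fst.eventually
          (gt_mem_nhds (show p.1 < lam / 2 by linarith))).mono fun q hq => Or.inl hq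
      · exact (continuousAt_snd.eventually
          (gt_mem_nhds (show p.2 < lam / 2 by linarith))).mono fun q hq => Or.inr hq
    filter_upwards [this] with q hq
    by_contra hne
    obtain ⟨hy, hz, -, -⟩ := Kreg_supp hζ hlam (Ne.symm hne)
    rcases hq with h | h <;> linarith

/-- The weight `(1+|X|)^{γ-1}`. -/
def weight (γ X : ℝ) : ℝ := (1 + |X|) ^ (γ - 1)

theorem continuous_weight (γ : ℝ) : Continuous (weight γ) := by
  refine Continuous.rpow_const (by fun_prop) fun x => Or.inl ?_
  positivity

theorem weight_pos (γ x : ℝ) : 0 < weight γ x := by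
  unfold weight
  positivity

theorem goodRate_rescaledRate (hγ : γ ∈ Ico (0:ℝ) 1) (hC : 0 < C) (hK : KernelHyp K γ C)
    (hζ : CutoffHyp ζ) (hlam : 0 < lam) {β : ℝ} (hβ : 0 ≤ β) :
    GoodRate (rescaledRate (Kreg K ζ lam) β) (weight γ)
      (C * ((2 / lam) ^ γ + 1) * (2 / lam + 1) ^ (1 - γ)) (2 / lam) where
  w_cont := continuous_weight γ
  w_pos := weight_pos γ
  w_anti := by
    intro x hx y hy hxy
    unfold weight
    rw [abs_of_nonneg (show 0 ≤ x from hx), abs_of_nonneg (show 0 ≤ y from hy)]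
    have : 0 < 1 + x := by linarith [show 0 ≤ x from hx]
    exact rpow_le_rpow_of_nonpos this (by linarith) (by linarith [hγ.2])
  M_nonneg := by positivity
  c_nonneg := by positivity
  cont := by
    have hcont : Continuous fun p : ℝ × ℝ × ℝ =>
        Kreg K ζ lam (p.2.1 * exp (-(β * p.1))) (p.2.2 * exp (-(β * p.1))) :=
      (continuous_Kreg hK hζ hlam).comp (by fun_prop : Continuous fun p : ℝ × ℝ × ℝ =>
        (p.2.1 * exp (-(β * p.1)), p.2.2 * exp (-(β * p.1))))
    refine continuous_iff_continuousAt.2 fun p => ?_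
    by_cases hp : p.2.2 = 0
    · refine (continuousAt_const (y := (0:ℝ))).congr ?_
      have hc : Continuous fun p : ℝ × ℝ × ℝ => p.2.2 * exp (-(β * p.1)) := by fun_prop
      have : p.2.2 * exp (-(β * p.1)) < lam / 2 := by
        rw [hp, zero_mul]
        positivity
      filter_upwards [hc.continuousAt.eventually (gt_mem_nhds this)] with q hq
      by_contra hne
      have h0 := (div_ne_zero_iff.1 (Ne.symm hne)).1
      have := (Kreg_supp hζ hlam h0).2.1
      linarith
    · exact hcont.continuousAt.div (by fun_prop) hp
  nonneg := by
    intro s Y Z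
    by_cases h : Kreg K ζ lam (Y * exp (-(β * s))) (Z * exp (-(β * s))) = 0
    · simp [rescaledRate, h]
    · have hz := (Kreg_supp hζ hlam h).2.1
      have hZ : 0 < Z := pos_of_mul_pos_left (by linarith) (exp_pos _).le
      exact div_nonneg (Kreg_nonneg hK hζ hlam _ _) hZ.le
  supp := by
    intro s Y Z h
    obtain ⟨hy, hz, hzy, -⟩ := Kreg_supp hζ hlam (div_ne_zero_iff.1 h).1
    have he := exp_pos (-(β * s))
    refine ⟨pos_of_mul_pos_left (by linarith) he.le, pos_of_mul_pos_left (by linarith) he.le, ?_⟩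
    rw [← mul_assoc] at hzy
    exact le_of_mul_le_mul_right hzy he
  bound := by
    intro s Y Z hs
    set c := 2 / lam with hc
    have hc0 : 0 < c := by positivity
    have hw := weight_pos γ Z
    by_cases h : rescaledRate (Kreg K ζ lam) β s Y Z = 0
    · rw [h]
      positivity
    obtain ⟨hy, hz, -, hyz⟩ := Kreg_supp hζ hlam (div_ne_zero_iff.1 h).1
    have he := exp_pos (-(β * s))
    have he1 : exp (-(β * s)) ≤ 1 := exp_le_one_iff.2 (neg_nonpos.2 (mul_nonneg hβ hs))
    rw [rescaledRate]
    set y := Y * exp (-(β * s)) with hydef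
    set z := Z * exp (-(β * s)) with hzdef
    have hy0 : 0 < y := by linarith
    have hz0 : 0 < z := by linarith
    have hZ : 0 < Z := pos_of_mul_pos_left (by linarith) he.le
    have hzZ : z ≤ Z := mul_le_of_le_one_right hZ.le he1
    have h1 : Kreg K ζ lam y z ≤ C * ((c ^ γ + 1) * Z ^ γ) := by
      refine (Kreg_le hK hζ hy0 hz0).trans ((hK.growth y z hy0 hz0).trans ?_)
      refine mul_le_mul_of_nonneg_left ?_ hC.le
      have a1 : y ^ γ ≤ c ^ γ * Z ^ γ := by
        rw [← mul_rpow hc0.le hZ.le]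
        refine rpow_le_rpow hy0.le (hyz.trans ?_) hγ.1
        exact mul_le_mul_of_nonneg_left hzZ hc0.le
      have a2 : z ^ γ ≤ Z ^ γ := rpow_le_rpow hz0.le hzZ hγ.1
      linarith
    have h2 : Z ^ γ / Z = Z ^ (γ - 1) := by rw [rpow_sub_one hZ.ne']
    have h3 : Z ^ (γ - 1) ≤ (c + 1) ^ (1 - γ) * weight γ Z := by
      have hcZ : 1 ≤ c * Z := by
        rw [hc, div_mul_eq_mul_div, le_div_iff₀ hlam]
        linarith
      have b1 : (c + 1) ^ (1 - γ) = ((c + 1)⁻¹) ^ (γ - 1) := by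
        rw [inv_rpow (by positivity), ← rpow_neg (by positivity), neg_sub]
      rw [weight, abs_of_pos hZ, b1, ← mul_rpow (by positivity) (by positivity)]
      refine rpow_le_rpow_of_nonpos (by positivity) ?_ (by linarith [hγ.2])
      rw [inv_mul_le_iff₀ (by positivity)]
      linarith
    calc Kreg K ζ lam y z / Z ≤ C * ((c ^ γ + 1) * Z ^ γ) / Z := by gcongr
      _ = C * (c ^ γ + 1) * Z ^ (γ - 1) := by rw [← h2]; ring
      _ ≤ C * (c ^ γ + 1) * ((c + 1) ^ (1 - γ) * weight γ Z) := by gcongr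
      _ = _ := by ring

end Kernel

theorem MemX.integrable_weight {γ ρ : ℝ} {μ : Measure ℝ} (hγ : γ < 1) (hρ : γ < ρ)
    (h : MemX ρ μ) : Integrable (weight γ) μ := by
  obtain ⟨h0, M, hM⟩ := h
  refine ⟨(continuous_weight γ).aestronglyMeasurable, ?_⟩
  rw [hasFiniteIntegral_iff_ofReal (Eventually.of_forall fun x => (weight_pos γ x).le)]
  set r : ℝ := 2 ^ (γ - 1) with hr
  have hr0 : 0 < r := by positivity
  have hpt : ∀ᵐ x ∂μ, ENNReal.ofReal (weight γ x)
      ≤ ∑' n : ℕ, (Icc (0:ℝ) (2 ^ (n + 1))).indicator (fun _ => ENNReal.ofReal (r ^ n)) x := by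
    filter_upwards [measure_Iio_zero_iff.1 h0] with x hx
    obtain ⟨n, hn1, hn2⟩ := exists_nat_pow_near (show 1 ≤ 1 + x by linarith) one_lt_two
    refine le_trans ?_ (ENNReal.le_tsum n)
    rw [indicator_of_mem (show x ∈ Icc (0:ℝ) (2 ^ (n + 1)) from ⟨hx, by linarith⟩)]
    refine ENNReal.ofReal_le_ofReal ?_
    have : r ^ n = ((2:ℝ) ^ n) ^ (γ - 1) := by
      rw [hr, ← rpow_natCast, ← rpow_natCast, ← rpow_mul zero_le_two, ← rpow_mul zero_le_two,
        mul_comm]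
    rw [this, weight, abs_of_nonneg hx]
    exact rpow_le_rpow_of_nonpos (by positivity) hn1 (by linarith)
  have hsum : Summable fun n : ℕ => M * 2 ^ (1 - ρ) * ((2:ℝ) ^ (γ - ρ)) ^ n :=
    (summable_geometric_of_lt_one (by positivity)
      (rpow_lt_one_of_one_lt_of_neg one_lt_two (by linarith))).mul_left _
  calc _ ≤ ∫⁻ x, ∑' n : ℕ,
        (Icc (0:ℝ) (2 ^ (n + 1))).indicator (fun _ => ENNReal.ofReal (r ^ n)) x ∂μ :=
        lintegral_mono_ae hpt
    _ = ∑' n : ℕ, ENNReal.ofReal (r ^ n) * μ (Icc (0:ℝ) (2 ^ (n + 1))) := by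
        rw [lintegral_tsum fun n => (measurable_const.indicator measurableSet_Icc).aemeasurable]
        congr 1
        ext n
        rw [lintegral_indicator_const measurableSet_Icc]
    _ ≤ ∑' n : ℕ, ENNReal.ofReal (M * 2 ^ (1 - ρ) * ((2:ℝ) ^ (γ - ρ)) ^ n) := by
        refine ENNReal.tsum_le_tsum fun n => ?_
        refine (mul_le_mul_right (hM _ (by positivity)) _).trans ?_
        rw [← ENNReal.ofReal_mul (by positivity)]
        refine (congrArg ENNReal.ofReal ?_).le
        have e1 : ((2:ℝ) ^ (n + 1)) ^ (1 - ρ) = 2 ^ (1 - ρ) * ((2:ℝ) ^ (1 - ρ)) ^ n := by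
          rw [pow_succ, mul_rpow (by positivity) zero_le_two, mul_comm]
          congr 1
          rw [← rpow_natCast, ← rpow_natCast, ← rpow_mul zero_le_two, ← rpow_mul zero_le_two,
            mul_comm]
        have e2 : (2:ℝ) ^ (γ - ρ) = r * 2 ^ (1 - ρ) := by
          rw [hr, ← rpow_add zero_lt_two]
          congr 1
          ring
        rw [e1, e2, mul_pow]
        ring
    _ < ⊤ := hsum.tsum_ofReal_lt_top

/-- Global well-posedness of the regularized problem: the unique mild solution extends to
all positive times, with the `λ`-independent bound
`sup_{0≤t≤T} ‖H(·,t)‖_{𝒳_ρ} ≤ ‖h₀‖_{𝒳_ρ} e^{βρT}` for every `T > 0`. -/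
theorem global_wellposedness_regularized
    (γ C ρ β lam : ℝ) (K : ℝ → ℝ → ℝ) (ζ : ℝ → ℝ)
    (hγ : γ ∈ Ico (0:ℝ) 1) (hC : 0 < C) (hK : KernelHyp K γ C) (hζ : CutoffHyp ζ)
    (hρ : ρ ∈ Ioo γ 1) (hβ : β = 1 / (ρ - γ)) (hlam : lam ∈ Ioo (0:ℝ) (1/2))
    (h0 : Measure ℝ) (hh0 : MemX ρ h0) :
    ∃ H : ℝ → Measure ℝ,
      (∀ T > (0:ℝ), IsMildSolution (Kreg K ζ lam) β ρ T h0 H) ∧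
      (∀ T > (0:ℝ), ∀ t ∈ Icc (0:ℝ) T,
        Xnorm ρ (H t) ≤ Xnorm ρ h0 * exp (β * ρ * T)) ∧
      (∀ T > (0:ℝ), ∀ H' : ℝ → Measure ℝ, IsMildSolution (Kreg K ζ lam) β ρ T h0 H' →
        ∀ t ∈ Icc (0:ℝ) T, H' t = H t) := by
  obtain ⟨hγρ, hρ1⟩ := hρ
  have hβ0 : 0 ≤ β := hβ ▸ one_div_nonneg.2 (sub_nonneg.2 hγρ.le)
  have hκ : 0 ≤ β * ρ := mul_nonneg hβ0 (hγ.1.trans hγρ.le)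
  have datum : ∀ T, 0 ≤ T → Datum (rescaledRate (Kreg K ζ lam) β) (weight γ)
      (C * ((2 / lam) ^ γ + 1) * (2 / lam + 1) ^ (1 - γ)) (2 / lam) (β * ρ) T
      (exp (β * ρ * T) * ∫ X, weight γ X ∂h0) h0 := fun T hT =>
    { rate := goodRate_rescaledRate hγ hC hK hζ hlam.1 hβ0
      κ_nonneg := hκ
      T_nonneg := hT
      fin := hh0.isFiniteMeasureOnCompacts
      int := hh0.integrable_weight hγ.2 hγρ
      bound := le_rfl }
  choose S hadm hmild using fun T : ℝ => exists_isMildSolution (datum |T| (abs_nonneg T)) hh0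
  have hS : ∀ T > 0, ∀ t ∈ Icc 0 T, S t t = S T t := fun T hT t ht =>
    IsMildSolution.unique (datum |t| (abs_nonneg t)) (hmild t)
      ((hmild T).mono (abs_le_abs_of_nonneg ht.1 ht.2)) ⟨ht.1, le_abs_self t⟩
  have hsol : ∀ T > 0, IsMildSolution (Kreg K ζ lam) β ρ T h0 fun t => S t t := fun T hT =>
    ((hmild T).mono (le_abs_self T)).congr (hS T hT)
  refine ⟨fun t => S t t, hsol, fun T hT t ht => ?_, fun T hT H' hH' t ht =>
    hH'.unique (datum T hT.le) (hsol T hT) ht⟩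
  have := (hadm t).weak.fin t
  have ht' : t ∈ Icc 0 |t| := ⟨ht.1, le_abs_self t⟩
  refine (Xnorm_le_of_spread hh0 (exp_pos _) ((hadm t).spread t ht')).trans ?_
  have hX : 0 ≤ Xnorm ρ h0 := Real.sInf_nonneg fun M hM => hM.1
  have := ht.2
  gcongr

end Smol
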